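/- arXiv:2511.06334 — 3 statements merged into one kernel-verified Lean document; each statement's English description precedes it below -/
import Mathlib

section
/- Let N ≥ 2, 0 < s < 1 < p, and N > sp. Let Ω ⊆ ℝ^N be an exterior domain and let u : ℝ^N → (0, ∞) be lower semicontinuous, and suppose that for every x ∈ Ω the fractional p-Laplacian (−Δ_p)^s u(x) exists in the principal-value sense with a value L(x) ≥ 0. Then for every θ ∈ ((N−sp)/(p−1), N/(p−1)) there exists a constant κ > 0 such that u(x) ≥ κ · min{1, |x|^{−θ}} for every x ∈ ℝ^N. -/
open MeasureTheory Filter Set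

/-- `(-Δ_p)^s u(x)` exists in the principal-value sense with value `L`:
for every `r > 0` the integrand is integrable on `{y : |x - y| > r}`, and the
truncated integrals converge to `L` as `r → 0⁺`. -/
noncomputable def pvFracPLap (N : ℕ) (s p : ℝ) (u : EuclideanSpace ℝ (Fin N) → ℝ)
    (x : EuclideanSpace ℝ (Fin N)) (L : ℝ) : Prop :=
  (∀ r : ℝ, 0 < r →
    IntegrableOn
      (fun y => |u x - u y| ^ (p - 2) * (u x - u y) * ‖x - y‖ ^ (-((N : ℝ) + s * p)))
      {y | r < ‖x - y‖} volume) ∧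
  Tendsto
    (fun r : ℝ => ∫ y in {y : EuclideanSpace ℝ (Fin N) | r < ‖x - y‖},
        |u x - u y| ^ (p - 2) * (u x - u y) * ‖x - y‖ ^ (-((N : ℝ) + s * p)))
    (nhdsWithin 0 (Set.Ioi 0)) (nhds L)

/-- The odd power function `a ↦ |a| ^ (p - 2) * a`. -/
noncomputable def signedRpow (p a : ℝ) : ℝ := |a| ^ (p - 2) * a

theorem signedRpow_of_nonneg {p a : ℝ} (hp : 1 < p) (ha : 0 ≤ a) :
    signedRpow p a = a ^ (p - 1) := by
  unfold signedRpow
  rcases ha.eq_or_lt with rfl | ha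
  · simp [Real.zero_rpow (sub_ne_zero.2 hp.ne')]
  · rw [abs_of_pos ha, ← Real.rpow_add_one ha.ne']
    congr 1; ring

theorem signedRpow_neg (p a : ℝ) : signedRpow p (-a) = -signedRpow p a := by
  simp [signedRpow]

theorem signedRpow_mul {p c : ℝ} (hp : 1 < p) (hc : 0 ≤ c) (a : ℝ) :
    signedRpow p (c * a) = c ^ (p - 1) * signedRpow p a := by
  rw [← signedRpow_of_nonneg hp hc]
  simp only [signedRpow, abs_mul, Real.mul_rpow (abs_nonneg _) (abs_nonneg _)]
  ring

theorem signedRpow_mono {p : ℝ} (hp : 1 < p) : Monotone (signedRpow p) := by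
  have hpos : ∀ {a b : ℝ}, 0 ≤ a → a ≤ b → signedRpow p a ≤ signedRpow p b := by
    intro a b ha hab
    rw [signedRpow_of_nonneg hp ha, signedRpow_of_nonneg hp (ha.trans hab)]
    exact Real.rpow_le_rpow ha hab (by linarith)
  have hz : signedRpow p 0 = 0 := by simp [signedRpow]
  intro a b hab
  rcases le_total 0 a with ha | ha
  · exact hpos ha hab
  · rcases le_total 0 b with hb | hb
    · have h1 := hpos le_rfl (neg_nonneg.2 ha)
      have h2 := hpos le_rfl hb
      rw [signedRpow_neg] at h1
      linarith
    · have h1 := hpos (neg_nonneg.2 hb) (neg_le_neg hab)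
      rw [signedRpow_neg, signedRpow_neg] at h1
      linarith

theorem measurable_signedRpow (p : ℝ) : Measurable (signedRpow p) := by
  unfold signedRpow
  fun_prop

/-- A version of Bernoulli's inequality. -/
theorem one_sub_rpow_le {θ t : ℝ} (ht0 : 0 ≤ t) (ht1 : t ≤ 1) :
    1 - t ^ θ ≤ max 1 θ * (1 - t) := by
  rcases le_total θ 1 with h | h
  · rw [max_eq_left h]
    rcases ht0.eq_or_lt with rfl | ht
    · have := Real.rpow_nonneg (le_refl (0:ℝ)) θ
      linarith
    · have := Real.rpow_le_rpow_of_exponent_ge ht ht1 h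
      rw [Real.rpow_one] at this
      linarith
  · rw [max_eq_right h]
    have := one_add_mul_self_le_rpow_one_add (s := t - 1) (by linarith) h
    rw [add_sub_cancel] at this
    linarith

section
variable {N : ℕ}

theorem integrableOn_norm_sub_rpow {α δ : ℝ} (hα : (N : ℝ) < α) (hδ : 0 < δ)
    (e : EuclideanSpace ℝ (Fin N)) :
    IntegrableOn (fun z => ‖e - z‖ ^ (-α)) {z | δ < ‖e - z‖} := by
  have hint : Integrable (fun z : EuclideanSpace ℝ (Fin N) => (1 + ‖e - z‖) ^ (-α)) :=
    (integrable_one_add_norm (μ := (volume : Measure (EuclideanSpace ℝ (Fin N))))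
      (r := α) (by simpa using hα)).comp_sub_left e
  refine (hint.const_mul ((δ / (1 + δ)) ^ (-α))).integrableOn.mono'
    (by fun_prop : Measurable _).aestronglyMeasurable
    ((ae_restrict_iff' (measurableSet_lt (by fun_prop) (by fun_prop))).2
      (.of_forall fun z hz => ?_))
  simp only [mem_ofPred_eq] at hz
  rw [Real.norm_of_nonneg (by positivity), ← Real.mul_rpow (by positivity) (by positivity)]
  have hN : (0 : ℝ) ≤ N := N.cast_nonneg
  refine Real.rpow_le_rpow_of_nonpos (by positivity) ?_ (by linarith)
  rw [div_mul_eq_mul_div, div_le_iff₀ (by positivity)]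
  nlinarith

theorem exists_tail_le {α : ℝ} (hα : (N : ℝ) < α) {ε : ℝ} (hε : 0 < ε) :
    ∃ ρ₀ : ℝ, ∀ ρ ≥ ρ₀, ∀ e : EuclideanSpace ℝ (Fin N), ‖e‖ = 1 →
      ∫ z in {z | ρ ≤ ‖z‖}, ‖e - z‖ ^ (-α) ≤ ε := by
  have hint : Integrable (fun z : EuclideanSpace ℝ (Fin N) => (1 / 2) ^ (-α) * (1 + ‖z‖) ^ (-α)) :=
    (integrable_one_add_norm (μ := (volume : Measure (EuclideanSpace ℝ (Fin N))))
      (r := α) (by simpa using hα)).const_mul _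
  have hmeas : ∀ ρ : ℝ, MeasurableSet {z : EuclideanSpace ℝ (Fin N) | ρ ≤ ‖z‖} := fun ρ =>
    measurableSet_le (by fun_prop) (by fun_prop)
  have hlim := tendsto_setIntegral_of_antitone (μ := volume)
    (s := fun ρ : ℝ => {z : EuclideanSpace ℝ (Fin N) | ρ ≤ ‖z‖}) hmeas
    (fun a b hab z (hz : b ≤ ‖z‖) => hab.trans hz) ⟨0, hint.integrableOn⟩
  have hempty : (⋂ ρ : ℝ, {z : EuclideanSpace ℝ (Fin N) | ρ ≤ ‖z‖}) = ∅ := by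
    ext z
    simp only [mem_iInter, mem_ofPred_eq, mem_empty_iff_false, iff_false, not_forall, not_le]
    exact exists_gt _
  rw [hempty, Measure.restrict_empty, integral_zero_measure] at hlim
  obtain ⟨ρ₁, h₁⟩ := eventually_atTop.1 (hlim.eventually (gt_mem_nhds hε))
  refine ⟨max ρ₁ 3, fun ρ hρ e he => le_trans ?_ (h₁ ρ ((le_max_left _ _).trans hρ)).le⟩
  have hρ3 : 3 ≤ ρ := (le_max_right _ _).trans hρ
  refine integral_mono_of_nonneg (.of_forall fun z => by positivity) hint.integrableOn
    ((ae_restrict_iff' (hmeas ρ)).2 (.of_forall fun z hz => ?_))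
  simp only [mem_ofPred_eq] at hz
  dsimp only
  have hN : (0 : ℝ) ≤ N := N.cast_nonneg
  rw [← Real.mul_rpow (by positivity) (by positivity)]
  refine Real.rpow_le_rpow_of_nonpos (by positivity) ?_ (by linarith)
  have := norm_sub_norm_le z e
  rw [norm_sub_rev] at this
  linarith

/-- Change of variables for the inversion in the unit sphere. -/
theorem setIntegral_image_inversion {S : Set (EuclideanSpace ℝ (Fin N))} (hS : MeasurableSet S)
    (h0 : 0 ∉ S) (g : EuclideanSpace ℝ (Fin N) → ℝ) :
    ∫ y in EuclideanGeometry.inversion 0 1 '' S, g y =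
      ∫ z in S, ‖z‖ ^ (-(2 * N : ℝ)) * g (EuclideanGeometry.inversion 0 1 z) := by
  rw [integral_image_eq_integral_abs_det_fderiv_smul volume hS
    (fun x hx => (EuclideanGeometry.hasFDerivAt_inversion
      (ne_of_mem_of_not_mem hx h0)).hasFDerivWithinAt)
    (EuclideanGeometry.inversion_injective 0 one_ne_zero).injOn]
  refine setIntegral_congr_fun hS fun z hz => ?_
  have hz0 : 0 < ‖z‖ := norm_pos_iff.2 (ne_of_mem_of_not_mem hz h0)
  rw [smul_eq_mul, ContinuousLinearMap.det, ContinuousLinearMap.toLinearMap_smul,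
    LinearMap.det_smul, abs_mul]
  have : |LinearMap.det (((ℝ ∙ (z - 0))ᗮ.reflection :
      EuclideanSpace ℝ (Fin N) →L[ℝ] EuclideanSpace ℝ (Fin N)) :
      EuclideanSpace ℝ (Fin N) →ₗ[ℝ] EuclideanSpace ℝ (Fin N))| = 1 := by
    have := Submodule.det_reflection (ℝ ∙ (z - 0))ᗮ
    erw [this]
    simp
  rw [this, mul_one, finrank_euclideanSpace_fin, dist_zero_right, abs_of_nonneg (by positivity)]
  congr 1
  rw [Real.rpow_neg hz0.le, one_div, inv_pow, inv_pow, ← pow_mul]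
  norm_cast

theorem norm_inversion_zero_one (z : EuclideanSpace ℝ (Fin N)) :
    ‖EuclideanGeometry.inversion 0 1 z‖ = ‖z‖⁻¹ := by
  have := EuclideanGeometry.dist_inversion_center (0 : EuclideanSpace ℝ (Fin N)) z 1
  simpa using this

theorem norm_sub_inversion {e z : EuclideanSpace ℝ (Fin N)} (he : ‖e‖ = 1) (hz : z ≠ 0) :
    ‖e - EuclideanGeometry.inversion 0 1 z‖ = ‖e - z‖ / ‖z‖ := by
  have he0 : e ≠ 0 := norm_pos_iff.1 (by rw [he]; exact one_pos)
  have h := EuclideanGeometry.dist_inversion_inversion he0 hz 1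
  rw [EuclideanGeometry.inversion_of_mem_sphere (by simpa using he)] at h
  simp only [he, dist_eq_norm, sub_zero] at h
  rw [h]
  ring

theorem image_inversion_annulus {e : EuclideanSpace ℝ (Fin N)} (he : ‖e‖ = 1) {ρ δ : ℝ}
    (hρ : 0 < ρ) :
    EuclideanGeometry.inversion 0 1 '' {z | ρ⁻¹ < ‖z‖ ∧ ‖z‖ < 1 ∧ δ * ‖z‖ < ‖e - z‖} =
      {y | 1 < ‖y‖ ∧ ‖y‖ < ρ ∧ δ < ‖e - y‖} := by
  rw [(EuclideanGeometry.inversion_involutive (0 : EuclideanSpace ℝ (Fin N))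
    one_ne_zero).image_eq_preimage_symm]
  ext y
  rcases eq_or_ne y 0 with rfl | hy
  · simp [hρ.le, not_lt.2, (zero_lt_one' ℝ).le]
  have hy' : 0 < ‖y‖ := norm_pos_iff.2 hy
  simp only [mem_preimage, mem_ofPred_eq, norm_inversion_zero_one, norm_sub_inversion he hy,
    inv_lt_inv₀ hρ hy', inv_lt_one₀ hy', ← div_eq_mul_inv, div_lt_div_iff_of_pos_right hy']
  tauto

/-- The integrand of the fractional `p`-Laplacian at a unit vector `e` of the rescaled barrier
`z ↦ (max ‖z‖ ρ⁻¹) ^ (-θ)`; here `σ` stands for the product `s * p`. -/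
noncomputable def barrierIntegrand (p θ σ ρ : ℝ) (e z : EuclideanSpace ℝ (Fin N)) : ℝ :=
  signedRpow p (1 - (max ‖z‖ ρ⁻¹) ^ (-θ)) * ‖e - z‖ ^ (-((N : ℝ) + σ))

/-- The common factor of the barrier integrand inside the unit ball and of its pull-back
by inversion. -/
noncomputable def barrierFactor (p θ σ : ℝ) (e z : EuclideanSpace ℝ (Fin N)) : ℝ :=
  (1 - ‖z‖ ^ θ) ^ (p - 1) * ‖e - z‖ ^ (-((N : ℝ) + σ))

theorem measurable_barrierIntegrand (p θ σ ρ : ℝ) (e : EuclideanSpace ℝ (Fin N)) :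
    Measurable (barrierIntegrand p θ σ ρ e) := by
  unfold barrierIntegrand
  have : Measurable fun z : EuclideanSpace ℝ (Fin N) => 1 - (max ‖z‖ ρ⁻¹) ^ (-θ) := by fun_prop
  exact ((measurable_signedRpow p).comp this).mul (by fun_prop)

theorem measurable_barrierFactor (p θ σ : ℝ) (e : EuclideanSpace ℝ (Fin N)) :
    Measurable (barrierFactor p θ σ e) := by
  unfold barrierFactor
  fun_prop

variable {p θ σ ρ : ℝ}

theorem barrierFactor_nonneg (hθ : 0 < θ) {e z : EuclideanSpace ℝ (Fin N)}
    (hz : ‖z‖ ≤ 1) : 0 ≤ barrierFactor p θ σ e z := by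
  have := Real.rpow_le_one (norm_nonneg z) hz hθ.le
  exact mul_nonneg (Real.rpow_nonneg (by linarith) _) (by positivity)

theorem barrierIntegrand_nonpos (hp : 1 < p) (hθ : 0 < θ) (hρ : 1 ≤ ρ)
    {e z : EuclideanSpace ℝ (Fin N)} (hz : ‖z‖ ≤ 1) : barrierIntegrand p θ σ ρ e z ≤ 0 := by
  have h1 : 1 ≤ (max ‖z‖ ρ⁻¹) ^ (-θ) :=
    Real.one_le_rpow_of_pos_of_le_one_of_nonpos (by positivity)
      (max_le hz (inv_le_one_of_one_le₀ hρ)) (by linarith)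
  have h2 := signedRpow_mono hp (sub_nonpos.2 h1)
  rw [show signedRpow p 0 = 0 by simp [signedRpow]] at h2
  exact mul_nonpos_of_nonpos_of_nonneg h2 (by positivity)

theorem barrierIntegrand_inner (hp : 1 < p) (hθ : 0 < θ) (hρ : 1 ≤ ρ)
    {e z : EuclideanSpace ℝ (Fin N)} (hz : ‖z‖ ≤ 1) (hzρ : ρ⁻¹ ≤ ‖z‖) :
    barrierIntegrand p θ σ ρ e z = -(barrierFactor p θ σ e z * ‖z‖ ^ (-(θ * (p - 1)))) := by
  have hz0 : 0 < ‖z‖ := lt_of_lt_of_le (by positivity) hzρ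
  have h1 := Real.rpow_le_one (norm_nonneg z) hz hθ.le
  have h2 : 1 - ‖z‖ ^ (-θ) = ‖z‖ ^ (-θ) * -(1 - ‖z‖ ^ θ) := by
    have : ‖z‖ ^ (-θ) * ‖z‖ ^ θ = 1 := by rw [← Real.rpow_add hz0]; simp
    linear_combination -this
  rw [barrierIntegrand, max_eq_left hzρ, h2, signedRpow_mul hp (by positivity), signedRpow_neg,
    signedRpow_of_nonneg hp (by linarith), ← Real.rpow_mul hz0.le, barrierFactor]
  ring_nf

theorem barrierIntegrand_inversion (hp : 1 < p) (hθ : 0 < θ) (hρ : 1 ≤ ρ)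
    {e z : EuclideanSpace ℝ (Fin N)} (he : ‖e‖ = 1) (hz0 : z ≠ 0) (hz : ‖z‖ ≤ 1) :
    ‖z‖ ^ (-(2 * N : ℝ)) * barrierIntegrand p θ σ ρ e (EuclideanGeometry.inversion 0 1 z) =
      barrierFactor p θ σ e z * ‖z‖ ^ (σ - N) := by
  have hz' : 0 < ‖z‖ := norm_pos_iff.2 hz0
  have h1 := Real.rpow_le_one (norm_nonneg z) hz hθ.le
  rw [barrierIntegrand, norm_inversion_zero_one, norm_sub_inversion he hz0, max_eq_left
    ((inv_le_one_of_one_le₀ hρ).trans ((one_le_inv₀ hz').2 hz)), Real.inv_rpow hz'.le,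
    Real.rpow_neg hz'.le θ, inv_inv, signedRpow_of_nonneg hp (by linarith),
    Real.div_rpow (norm_nonneg _) hz'.le, barrierFactor, div_eq_mul_inv,
    ← Real.rpow_neg hz'.le (-_)]
  have : ‖z‖ ^ (σ - N) = ‖z‖ ^ (-(2 * N : ℝ)) * ‖z‖ ^ (- -((N : ℝ) + σ)) := by
    rw [← Real.rpow_add hz']
    ring_nf
  rw [this]
  ring

theorem barrierIntegrand_le (hp : 1 < p) (hρ : 0 < ρ) (e z : EuclideanSpace ℝ (Fin N)) :
    barrierIntegrand p θ σ ρ e z ≤ ‖e - z‖ ^ (-((N : ℝ) + σ)) := by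
  have h1 : signedRpow p (1 - (max ‖z‖ ρ⁻¹) ^ (-θ)) ≤ signedRpow p 1 :=
    signedRpow_mono hp (sub_le_self _ (by positivity))
  rw [signedRpow_of_nonneg hp zero_le_one, Real.one_rpow] at h1
  exact mul_le_of_le_one_left (by positivity) h1

theorem integrableOn_barrierIntegrand (hp : 1 < p) (hθ : 0 < θ) (hσ : 0 < σ) (hρ : 0 < ρ)
    (e : EuclideanSpace ℝ (Fin N)) {δ : ℝ} (hδ : 0 < δ) :
    IntegrableOn (barrierIntegrand p θ σ ρ e) {z | δ < ‖e - z‖} := by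
  refine ((integrableOn_norm_sub_rpow (show (N : ℝ) < N + σ by linarith) hδ e).const_mul
    (signedRpow p (1 + ρ ^ θ))).mono' (measurable_barrierIntegrand p θ σ ρ e).aestronglyMeasurable
    (.of_forall fun z => ?_)
  rw [barrierIntegrand, norm_mul, Real.norm_of_nonneg (Real.rpow_nonneg (norm_nonneg (e - z)) _)]
  refine mul_le_mul_of_nonneg_right ?_ (by positivity)
  have h1 : (max ‖z‖ ρ⁻¹) ^ (-θ) ≤ ρ ^ θ := by
    rw [Real.rpow_neg (by positivity), ← Real.inv_rpow (by positivity)]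
    refine Real.rpow_le_rpow (by positivity) ?_ hθ.le
    exact inv_le_of_inv_le₀ hρ (le_max_right _ _)
  have h2 : 0 ≤ (max ‖z‖ ρ⁻¹) ^ (-θ) := by positivity
  have h3 : 0 ≤ ρ ^ θ := by positivity
  rw [Real.norm_eq_abs, abs_le, ← signedRpow_neg]
  exact ⟨signedRpow_mono hp (by linarith), signedRpow_mono hp (by linarith)⟩

theorem integrableOn_barrierFactor_mul (hp : 1 < p) (hθ : 0 < θ) (hσ : 0 < σ) (hρ : 0 < ρ)
    (e : EuclideanSpace ℝ (Fin N)) {δ γ : ℝ} (hδ : 0 < δ) (hγ : γ ≤ 0) :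
    IntegrableOn (fun z => barrierFactor p θ σ e z * ‖z‖ ^ γ)
      {z | ρ⁻¹ < ‖z‖ ∧ ‖z‖ < 1 ∧ δ * ‖z‖ < ‖e - z‖} := by
  have hmeas : MeasurableSet {z : EuclideanSpace ℝ (Fin N) |
      ρ⁻¹ < ‖z‖ ∧ ‖z‖ < 1 ∧ δ * ‖z‖ < ‖e - z‖} := by measurability
  have hfin : volume {z : EuclideanSpace ℝ (Fin N) |
      ρ⁻¹ < ‖z‖ ∧ ‖z‖ < 1 ∧ δ * ‖z‖ < ‖e - z‖} < ⊤ :=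
    (measure_mono fun z hz => by simpa using hz.2.1).trans_lt
      (measure_ball_lt_top (x := (0 : EuclideanSpace ℝ (Fin N))) (r := 1))
  refine IntegrableOn.of_bound hfin
    ((measurable_barrierFactor p θ σ e).mul (by fun_prop)).aestronglyMeasurable
    ((δ * ρ⁻¹) ^ (-((N : ℝ) + σ)) * ρ⁻¹ ^ γ)
    ((ae_restrict_iff' hmeas).2 (.of_forall fun z hz => ?_))
  obtain ⟨h1, h2, h3⟩ := hz
  have hN : (0 : ℝ) ≤ N := N.cast_nonneg
  have h4 := Real.rpow_le_one (norm_nonneg z) h2.le hθ.le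
  have h5 := Real.rpow_nonneg (norm_nonneg z) θ
  rw [norm_mul, Real.norm_of_nonneg (barrierFactor_nonneg hθ h2.le),
    Real.norm_of_nonneg (by positivity)]
  refine mul_le_mul ?_ (Real.rpow_le_rpow_of_nonpos (by positivity) h1.le hγ)
    (by positivity) (by positivity)
  refine (mul_le_of_le_one_left (by positivity)
    (Real.rpow_le_one (by linarith) (by linarith) (by linarith))).trans
    (Real.rpow_le_rpow_of_nonpos (by positivity) ?_ (by linarith))
  exact (mul_le_mul_of_nonneg_left h1.le hδ.le).trans h3.le

theorem shell_integral_le (hp : 1 < p) (hθ : 0 < θ) (hσ : 0 < σ) (hσN : σ < N) (ρ : ℝ)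
    {e : EuclideanSpace ℝ (Fin N)} (he : ‖e‖ = 1) {δ : ℝ} (hδ : 0 < δ) (hδ' : δ < 1 / 2) :
    ∫ z in {z | ρ⁻¹ < ‖z‖ ∧ ‖z‖ < 1 ∧ δ * ‖z‖ < ‖e - z‖} \ {z | δ < ‖e - z‖},
        barrierFactor p θ σ e z * ‖z‖ ^ (σ - N) ≤
      (max 1 θ) ^ (p - 1) * (1 / 2) ^ (-((N : ℝ) + σ)) * (1 / 2) ^ (σ - N) * N *
        volume.real (Metric.ball (0 : EuclideanSpace ℝ (Fin N)) 1) * δ ^ (p - σ) := by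
  set X := {z : EuclideanSpace ℝ (Fin N) | ρ⁻¹ < ‖z‖ ∧ ‖z‖ < 1 ∧ δ * ‖z‖ < ‖e - z‖} \
    {z | δ < ‖e - z‖}
  set V := volume.real (Metric.ball (0 : EuclideanSpace ℝ (Fin N)) 1)
  have hmem : ∀ z ∈ X, ‖z‖ < 1 ∧ 1 - δ ≤ ‖z‖ ∧ δ * ‖z‖ < ‖e - z‖ ∧ ‖e - z‖ ≤ δ := by
    rintro z ⟨⟨-, h2, h3⟩, h4⟩
    have h4 : ‖e - z‖ ≤ δ := not_lt.1 h4
    have := norm_sub_norm_le e z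
    exact ⟨h2, by linarith, h3, h4⟩
  have hsub : X ⊆ Metric.closedBall e δ \ Metric.closedBall e (δ * (1 - δ)) := by
    intro z hz
    obtain ⟨h1, h2, h3, h4⟩ := hmem z hz
    rw [Set.mem_sdiff, Metric.mem_closedBall, Metric.mem_closedBall, dist_comm, dist_eq_norm, not_le]
    exact ⟨h4, (mul_le_mul_of_nonneg_left h2 hδ.le).trans_lt h3⟩
  have hvol : volume.real X ≤ δ ^ (N : ℝ) * (N * δ) * V := by
    have hδ1 : 0 ≤ δ * (1 - δ) := mul_nonneg hδ.le (by linarith)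
    refine (measureReal_mono hsub
      (measure_ne_top_of_subset sdiff_subset measure_closedBall_lt_top.ne)).trans ?_
    rw [measureReal_sdiff (Metric.closedBall_subset_closedBall (by nlinarith))
      Metric.isClosed_closedBall.measurableSet measure_closedBall_lt_top.ne,
      Measure.addHaar_real_closedBall _ _ hδ.le, Measure.addHaar_real_closedBall _ _ hδ1,
      finrank_euclideanSpace_fin, mul_pow, Real.rpow_natCast]
    have hb := one_add_mul_le_pow (a := -δ) (by linarith) N
    rw [← sub_eq_add_neg] at hb
    have hV : 0 ≤ δ ^ N * V := by positivity
    nlinarith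
  have hfin : volume X < ⊤ :=
    measure_lt_top_of_subset (hsub.trans sdiff_subset) measure_closedBall_lt_top.ne
  have hN : (0 : ℝ) ≤ N := N.cast_nonneg
  have hbound := norm_setIntegral_le_of_norm_le_const (f := fun z =>
    barrierFactor p θ σ e z * ‖z‖ ^ (σ - N)) (C := (max 1 θ * δ) ^ (p - 1) *
      (δ * (1 / 2)) ^ (-((N : ℝ) + σ)) * (1 / 2) ^ (σ - N)) hfin (fun z hz => by
    obtain ⟨h1, h2, h3, h4⟩ := hmem z hz
    have h5 := Real.rpow_le_one (norm_nonneg z) h1.le hθ.le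
    rw [Real.norm_of_nonneg (mul_nonneg (barrierFactor_nonneg hθ h1.le) (by positivity))]
    unfold barrierFactor
    refine mul_le_mul (mul_le_mul (Real.rpow_le_rpow (by linarith) ?_ (by linarith))
      (Real.rpow_le_rpow_of_nonpos (by positivity) ?_ (by linarith)) (by positivity)
      (by positivity))
      (Real.rpow_le_rpow_of_nonpos (by positivity) (by linarith) (by linarith))
      (by positivity) (by positivity)
    · exact (one_sub_rpow_le (norm_nonneg z) h1.le).trans
        (mul_le_mul_of_nonneg_left (by linarith) (by positivity))
    · nlinarith)
  refine (le_abs_self _).trans (hbound.trans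
    ((mul_le_mul_of_nonneg_left hvol (by positivity)).trans_eq ?_))
  rw [Real.mul_rpow (by positivity) hδ.le, Real.mul_rpow hδ.le (by positivity),
    show p - σ = (p - 1) + (-((N : ℝ) + σ)) + N + 1 by ring, Real.rpow_add_one hδ.ne',
    Real.rpow_add hδ, Real.rpow_add hδ]
  ring

theorem exists_annulus_lower_bound (hp : 1 < p) (hθ : 0 < θ) (hσ : 0 < σ) (hσN : σ < N)
    (hcrit : N - σ < θ * (p - 1)) :
    ∃ c : ℝ, 0 < c ∧ ∀ e z : EuclideanSpace ℝ (Fin N), ‖e‖ = 1 → 1 / 4 < ‖z‖ → ‖z‖ < 1 / 2 →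
      c ≤ barrierFactor p θ σ e z * ‖z‖ ^ (-(θ * (p - 1))) -
        barrierFactor p θ σ e z * ‖z‖ ^ (σ - N) := by
  have hhalf : (1 / 2 : ℝ) ^ θ < 1 := Real.rpow_lt_one (by norm_num) (by norm_num) hθ
  have hγ : 1 < (1 / 2 : ℝ) ^ (-(θ * (p - 1) - N + σ)) :=
    Real.one_lt_rpow_of_pos_of_lt_one_of_neg (by norm_num) (by norm_num) (by linarith)
  refine ⟨(1 - (1 / 2) ^ θ) ^ (p - 1) * (3 / 2) ^ (-((N : ℝ) + σ)) *
    ((1 / 2) ^ (-(θ * (p - 1) - N + σ)) - 1), ?_, fun e z he h1 h2 => ?_⟩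
  · have := Real.rpow_pos_of_pos (sub_pos.2 hhalf) (p - 1)
    have := sub_pos.2 hγ
    positivity
  have hz : 0 < ‖z‖ := by linarith
  have h3 : ‖z‖ ^ θ ≤ (1 / 2) ^ θ := Real.rpow_le_rpow hz.le h2.le hθ.le
  have h4 : (1 / 2 : ℝ) ^ (-(θ * (p - 1) - N + σ)) ≤ ‖z‖ ^ (-(θ * (p - 1) - N + σ)) :=
    Real.rpow_le_rpow_of_nonpos hz h2.le (by linarith)
  have h5 : 1 ≤ ‖z‖ ^ (σ - N) :=
    Real.one_le_rpow_of_pos_of_le_one_of_nonpos hz (by linarith) (by linarith)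
  have h6 : ‖z‖ ^ (-(θ * (p - 1))) = ‖z‖ ^ (σ - N) * ‖z‖ ^ (-(θ * (p - 1) - N + σ)) := by
    rw [← Real.rpow_add hz]
    ring_nf
  have h7 : 1 / 2 ≤ ‖e - z‖ ∧ ‖e - z‖ ≤ 3 / 2 := by
    have := norm_sub_norm_le e z
    have := norm_sub_le e z
    constructor <;> linarith
  have hN : (0 : ℝ) ≤ N := N.cast_nonneg
  rw [h6, ← mul_sub]
  refine mul_le_mul (mul_le_mul (Real.rpow_le_rpow (by linarith) (by linarith) (by linarith))
    (Real.rpow_le_rpow_of_nonpos (by linarith) h7.2 (by linarith)) (by positivity)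
    (Real.rpow_nonneg (by linarith) _)) ?_ (by linarith)
    (barrierFactor_nonneg hθ (by linarith))
  nlinarith

/-- The rescaled barrier is a strict subsolution at unit vectors, uniformly in the scale. -/
theorem exists_barrierIntegrand_integral_le (hN : 1 ≤ N) (hp : 1 < p) (hθ : 0 < θ) (hσ : 0 < σ)
    (hσN : σ < N) (hσp : σ < p) (hcrit : N - σ < θ * (p - 1)) :
    ∃ c : ℝ, 0 < c ∧ ∃ ρ₀ : ℝ, ∀ ρ ≥ ρ₀, ∀ e : EuclideanSpace ℝ (Fin N), ‖e‖ = 1 →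
      ∀ᶠ δ in nhdsWithin 0 (Ioi 0),
        ∫ z in {z | δ < ‖e - z‖}, barrierIntegrand p θ σ ρ e z ≤ -c := by
  obtain ⟨c₀, hc₀, hann⟩ := exists_annulus_lower_bound hp hθ hσ hσN hcrit
  set A := {z : EuclideanSpace ℝ (Fin N) | 1 / 4 < ‖z‖ ∧ ‖z‖ < 1 / 2}
  have hAo : IsOpen A := (isOpen_lt continuous_const continuous_norm).inter
    (isOpen_lt continuous_norm continuous_const)
  have hAfin : volume A < ⊤ :=
    (measure_mono fun z hz => by simpa using hz.2).trans_lt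
      (measure_ball_lt_top (x := (0 : EuclideanSpace ℝ (Fin N))) (r := 1 / 2))
  have hAne : A.Nonempty := by
    have : Nonempty (Fin N) := ⟨⟨0, hN⟩⟩
    obtain ⟨z, hz⟩ := exists_norm_eq (EuclideanSpace ℝ (Fin N)) (c := 3 / 8) (by norm_num)
    refine ⟨z, ?_, ?_⟩ <;> rw [hz] <;> norm_num
  have hApos : 0 < volume.real A :=
    ENNReal.toReal_pos (hAo.measure_pos volume hAne).ne' hAfin.ne
  set m := c₀ * volume.real A
  have hm : 0 < m := mul_pos hc₀ hApos
  obtain ⟨ρ₁, htail⟩ := exists_tail_le (show (N : ℝ) < N + σ by linarith)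
    (show 0 < m / 4 by positivity)
  refine ⟨m / 2, by positivity, max ρ₁ 4, fun ρ hρ e he => ?_⟩
  have hρ4 : 4 ≤ ρ := (le_max_right _ _).trans hρ
  have hlim : Tendsto (fun δ : ℝ => (max 1 θ) ^ (p - 1) * (1 / 2) ^ (-((N : ℝ) + σ)) *
      (1 / 2) ^ (σ - N) * N * volume.real (Metric.ball (0 : EuclideanSpace ℝ (Fin N)) 1) *
      δ ^ (p - σ)) (nhdsWithin 0 (Ioi 0)) (nhds 0) := by
    have := ((Real.continuousAt_rpow_const 0 (p - σ) (Or.inr (by linarith))).tendsto.const_mul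
      ((max 1 θ) ^ (p - 1) * (1 / 2) ^ (-((N : ℝ) + σ)) *
      (1 / 2) ^ (σ - N) * N * volume.real (Metric.ball (0 : EuclideanSpace ℝ (Fin N)) 1)))
    rw [Real.zero_rpow (by linarith), mul_zero] at this
    exact this.mono_left nhdsWithin_le_nhds
  filter_upwards [hlim.eventually (gt_mem_nhds (show 0 < m / 4 by positivity)),
    self_mem_nhdsWithin, mem_nhdsWithin_of_mem_nhds
    (gt_mem_nhds (show (0 : ℝ) < 1 / 2 by norm_num))]
    with δ hδm hδ0 hδ2
  have hδ : 0 < δ := hδ0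
  set D := {z : EuclideanSpace ℝ (Fin N) | δ < ‖e - z‖}
  set S' := {z : EuclideanSpace ℝ (Fin N) | ρ⁻¹ < ‖z‖ ∧ ‖z‖ < 1 ∧ δ * ‖z‖ < ‖e - z‖}
  set S := {z : EuclideanSpace ℝ (Fin N) | ρ⁻¹ < ‖z‖ ∧ ‖z‖ < 1 ∧ δ < ‖e - z‖}
  set B := {z : EuclideanSpace ℝ (Fin N) | ‖z‖ ≤ 1}
  set T := {z : EuclideanSpace ℝ (Fin N) | ρ ≤ ‖z‖}
  set f := barrierIntegrand p θ σ ρ e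
  set G := fun z => barrierFactor p θ σ e z * ‖z‖ ^ (σ - N)
  set G' := fun z => barrierFactor p θ σ e z * ‖z‖ ^ (-(θ * (p - 1)))
  have hD : MeasurableSet D := measurableSet_lt (by fun_prop) (by fun_prop)
  have hB : MeasurableSet B := measurableSet_le (by fun_prop) (by fun_prop)
  have hT : MeasurableSet T := measurableSet_le (by fun_prop) (by fun_prop)
  have hS' : MeasurableSet S' := by measurability
  have hS : MeasurableSet S := by measurability
  have hfD : IntegrableOn f D := integrableOn_barrierIntegrand hp hθ hσ (by linarith) e hδ
  have hSS' : S ⊆ S' := fun z ⟨h1, h2, h3⟩ => ⟨h1, h2, by nlinarith⟩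
  have hGS' : IntegrableOn G S' :=
    integrableOn_barrierFactor_mul hp hθ hσ (by linarith) e hδ (by linarith)
  have hG'S : IntegrableOn G' S :=
    (integrableOn_barrierFactor_mul hp hθ hσ (by linarith) e hδ
      (neg_nonpos.2 (mul_nonneg hθ.le (by linarith)))).mono_set hSS'
  have hsplit : ∫ z in D, f z =
      (∫ z in D ∩ B, f z) + ((∫ z in (D \ B) ∩ T, f z) + ∫ z in (D \ B) \ T, f z) := by
    rw [integral_inter_add_sdiff hT (hfD.mono_set sdiff_subset),
      integral_inter_add_sdiff hB hfD]
  have hinner : ∫ z in D ∩ B, f z ≤ -∫ z in S, G' z := by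
    have h1 : ∫ z in S, -f z ≤ ∫ z in D ∩ B, -f z := by
      refine setIntegral_mono_set (hfD.mono_set inter_subset_left).neg
        ((ae_restrict_iff' (hD.inter hB)).2 (.of_forall fun z hz => ?_))
        (LE.le.eventuallyLE fun z ⟨_, h2, h3⟩ => ⟨h3, h2.le⟩)
      exact neg_nonneg.2 (barrierIntegrand_nonpos hp hθ (by linarith) hz.2)
    have h2 : ∫ z in S, -f z = ∫ z in S, G' z :=
      setIntegral_congr_fun hS fun z hz => by
        simp only [f, barrierIntegrand_inner hp hθ (by linarith) hz.2.1.le hz.1.le, neg_neg, G']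
    rw [← h2]
    rw [integral_neg] at h1 ⊢
    rw [integral_neg] at h1
    linarith
  have htl : ∫ z in (D \ B) ∩ T, f z ≤ m / 4 := by
    refine le_trans ?_ (htail ρ ((le_max_left _ _).trans hρ) e he)
    have hk : IntegrableOn (fun z => ‖e - z‖ ^ (-((N : ℝ) + σ))) T := by
      refine (integrableOn_norm_sub_rpow (by linarith) one_pos e).mono_set fun z hz => ?_
      have : ρ ≤ ‖z‖ := hz
      have := norm_sub_norm_le z e
      rw [norm_sub_rev] at this
      simp only [mem_ofPred_eq]
      linarith
    refine (setIntegral_mono_on (hfD.mono_set (inter_subset_left.trans sdiff_subset))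
      (hk.mono_set inter_subset_right) ((hD.diff hB).inter hT)
      fun z _ => barrierIntegrand_le hp (by linarith) e z).trans ?_
    exact setIntegral_mono_set hk (.of_forall fun z => by positivity)
      (LE.le.eventuallyLE inter_subset_right)
  have houter : ∫ z in (D \ B) \ T, f z = (∫ z in S, G z) + ∫ z in S' \ D, G z := by
    have h1 : (D \ B) \ T = EuclideanGeometry.inversion 0 1 '' S' := by
      rw [image_inversion_annulus he (by linarith)]
      ext z
      simp only [D, B, T, Set.mem_sdiff, mem_ofPred_eq, not_le]
      tauto
    have h2 : S' ∩ D = S := by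
      ext z
      simp only [S', D, S, mem_inter_iff, mem_ofPred_eq]
      exact ⟨fun h => ⟨h.1.1, h.1.2.1, h.2⟩, fun h => ⟨hSS' h, h.2.2⟩⟩
    have h0 : (0 : EuclideanSpace ℝ (Fin N)) ∉ S' := by
      simp only [S', mem_ofPred_eq, norm_zero, not_and]
      intro h
      linarith [inv_pos.2 (show 0 < ρ by linarith)]
    rw [h1, setIntegral_image_inversion hS' h0, ← h2, integral_inter_add_sdiff hD hGS']
    exact setIntegral_congr_fun hS' fun z hz => barrierIntegrand_inversion hp hθ (by linarith) he
      (ne_of_mem_of_not_mem hz h0) hz.2.1.le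
  have hshell := shell_integral_le hp hθ hσ hσN ρ he hδ hδ2
  have hlower : m ≤ (∫ z in S, G' z) - ∫ z in S, G z := by
    rw [← integral_sub hG'S (hGS'.mono_set hSS')]
    have hAS : A ⊆ S := fun z ⟨h1, h2⟩ => by
      have h3 : ρ⁻¹ ≤ 1 / 4 := by
        rw [one_div]
        exact inv_anti₀ (by norm_num) hρ4
      have := norm_sub_norm_le e z
      exact ⟨by linarith, by linarith, by linarith⟩
    have hint : IntegrableOn (fun z => G' z - G z) S := hG'S.sub (hGS'.mono_set hSS')
    refine (setIntegral_ge_of_const_le_real hAo.measurableSet hAfin.ne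
      (fun z hz => hann e z he hz.1 hz.2) (hint.mono_set hAS)).trans
      (setIntegral_mono_set hint ((ae_restrict_iff' hS).2 (.of_forall fun z hz => ?_))
        (LE.le.eventuallyLE hAS))
    have hz0 : 0 < ‖z‖ := lt_trans (inv_pos.2 (by linarith)) hz.1
    exact sub_nonneg.2 (mul_le_mul_of_nonneg_left
      (Real.rpow_le_rpow_of_exponent_ge hz0 hz.2.1.le (by linarith))
      (barrierFactor_nonneg hθ hz.2.1.le))
  linarith

theorem max_rpow_smul {z : EuclideanSpace ℝ (Fin N)} (hρ : 0 < ρ) :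
    (max ‖ρ • z‖ 1) ^ (-θ) = ρ ^ (-θ) * (max ‖z‖ ρ⁻¹) ^ (-θ) := by
  rw [← Real.mul_rpow hρ.le (by positivity), mul_max_of_nonneg _ _ hρ.le, mul_inv_cancel₀ hρ.ne',
    norm_smul, Real.norm_of_nonneg hρ.le]

/-- If `u` is touched from below, up to an additive constant, by a multiple of the barrier
`(max ‖y‖ 1) ^ (-θ)` at a point far from the origin, then its fractional `p`-Laplacian is
negative there. -/
theorem exists_neg_of_barrier_touching (hN : 1 ≤ N) {s : ℝ} (hp : 1 < p) (hs : 0 < s) (hs1 : s < 1)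
    (hθ : 0 < θ) (hσN : s * p < N) (hcrit : N - s * p < θ * (p - 1)) :
    ∃ ρ₀ : ℝ, ∀ (u : EuclideanSpace ℝ (Fin N) → ℝ) (x : EuclideanSpace ℝ (Fin N)) (κ L : ℝ),
      ρ₀ ≤ ‖x‖ → 0 < κ →
      (∀ y, u x - u y ≤ κ * ((max ‖x‖ 1) ^ (-θ) - (max ‖y‖ 1) ^ (-θ))) →
      pvFracPLap N s p u x L → L < 0 := by
  have hσ : 0 < s * p := by positivity
  obtain ⟨c, hc, ρ₁, hbar⟩ := exists_barrierIntegrand_integral_le hN hp hθ hσ hσN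
    (by nlinarith) hcrit
  refine ⟨max ρ₁ 1, fun u x κ L hx hκ htouch ⟨hint, hlim⟩ => ?_⟩
  obtain ⟨ρ, hρ⟩ : ∃ ρ, ρ = ‖x‖ := ⟨_, rfl⟩
  have hρ1 : 1 ≤ ρ := hρ ▸ (le_max_right _ _).trans hx
  have hρ0 : 0 < ρ := by linarith
  obtain ⟨e, he, rfl⟩ : ∃ e : EuclideanSpace ℝ (Fin N), ‖e‖ = 1 ∧ x = ρ • e := by
    refine ⟨ρ⁻¹ • x, ?_, ?_⟩
    · rw [norm_smul, Real.norm_of_nonneg (by positivity), ← hρ, inv_mul_cancel₀ hρ0.ne']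
    · rw [smul_smul, mul_inv_cancel₀ hρ0.ne', one_smul]
  have hnorm : ∀ z, ‖ρ • e - ρ • z‖ = ρ * ‖e - z‖ := fun z => by
    rw [← smul_sub, norm_smul, Real.norm_of_nonneg hρ0.le]
  set F := fun y => signedRpow p (u (ρ • e) - u y) * ‖ρ • e - y‖ ^ (-((N : ℝ) + s * p))
  set C := (κ * ρ ^ (-θ)) ^ (p - 1) * ρ ^ (-((N : ℝ) + s * p))
  have hC : 0 < C := by positivity
  have hF : ∀ z, F (ρ • z) ≤ C * barrierIntegrand p θ (s * p) ρ e z := by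
    intro z
    have h1 := htouch (ρ • z)
    have h2 : (max ‖ρ • e‖ 1) ^ (-θ) = ρ ^ (-θ) := by rw [← hρ, max_eq_left hρ1]
    rw [h2, max_rpow_smul hρ0] at h1
    have h3 := signedRpow_mono hp (h1.trans_eq (show _ = κ * ρ ^ (-θ) *
      (1 - (max ‖z‖ ρ⁻¹) ^ (-θ)) by ring))
    rw [signedRpow_mul hp (by positivity)] at h3
    simp only [F, C, barrierIntegrand, hnorm, Real.mul_rpow hρ0.le (norm_nonneg (e - z))]
    refine (mul_le_mul_of_nonneg_right h3 (by positivity)).trans_eq ?_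
    ring
  have hbound : ∀ᶠ δ in nhdsWithin (0 : ℝ) (Ioi 0),
      ∫ y in {y | ρ * δ < ‖ρ • e - y‖}, F y ≤ -(ρ ^ N * (C * c)) := by
    filter_upwards [hbar ρ (hρ ▸ (le_max_left _ _).trans hx) e he, self_mem_nhdsWithin]
      with δ hδ hδ0
    have hδ0 : 0 < δ := hδ0
    have hD : MeasurableSet {z : EuclideanSpace ℝ (Fin N) | δ < ‖e - z‖} :=
      measurableSet_lt (by fun_prop) (by fun_prop)
    have hD' : MeasurableSet {y : EuclideanSpace ℝ (Fin N) | ρ * δ < ‖ρ • e - y‖} :=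
      measurableSet_lt (by fun_prop) (by fun_prop)
    have hind : ∀ z, {z | δ < ‖e - z‖}.indicator (fun z => F (ρ • z)) z =
        {y | ρ * δ < ‖ρ • e - y‖}.indicator F (ρ • z) := by
      intro z
      simp only [indicator_apply, mem_ofPred_eq, hnorm, mul_lt_mul_iff_right₀ hρ0]
    have hFint : IntegrableOn (fun z => F (ρ • z)) {z | δ < ‖e - z‖} := by
      rw [← integrable_indicator_iff hD, funext hind,
        integrable_comp_smul_iff volume _ hρ0.ne', integrable_indicator_iff hD']
      exact hint (ρ * δ) (by positivity)
    have hscale : ∫ y in {y | ρ * δ < ‖ρ • e - y‖}, F y =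
        ρ ^ N * ∫ z in {z | δ < ‖e - z‖}, F (ρ • z) := by
      rw [← integral_indicator hD, funext hind, Measure.integral_comp_smul_of_nonneg _ _ _
        (hR := hρ0.le), integral_indicator hD', finrank_euclideanSpace_fin, smul_eq_mul,
        mul_inv_cancel_left₀ (by positivity)]
    rw [hscale, ← mul_neg]
    refine mul_le_mul_of_nonneg_left ?_ (by positivity)
    refine (setIntegral_mono_on hFint ((integrableOn_barrierIntegrand hp hθ hσ hρ0 e
      hδ0).const_mul C) hD fun z _ => hF z).trans ?_
    rw [integral_const_mul, ← mul_neg]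
    exact mul_le_mul_of_nonneg_left hδ hC.le
  have hdil : Tendsto (fun δ : ℝ => ρ * δ) (nhdsWithin 0 (Ioi 0)) (nhdsWithin 0 (Ioi 0)) := by
    refine tendsto_nhdsWithin_iff.2 ⟨?_, ?_⟩
    · have : Tendsto (fun δ : ℝ => ρ * δ) (nhds 0) (nhds (ρ * 0)) := tendsto_id.const_mul ρ
      rw [mul_zero] at this
      exact this.mono_left nhdsWithin_le_nhds
    · filter_upwards [self_mem_nhdsWithin] with δ hδ using mul_pos hρ0 hδ
  exact (le_of_tendsto (hlim.comp hdil) hbound).trans_lt (neg_neg_of_pos (by positivity))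

/-- A comparison principle: a positive lower semicontinuous function lies above a multiple of a
bounded continuous function `w` vanishing at infinity, or else is touched from below far out. -/
theorem le_of_forall_touching {u w : EuclideanSpace ℝ (Fin N) → ℝ} {R κ : ℝ}
    (hpos : ∀ x, 0 < u x) (hlsc : LowerSemicontinuous u) (hw : Continuous w)
    (hwlim : Tendsto w (cocompact _) (nhds 0)) (hin : ∀ x, ‖x‖ ≤ R → κ * w x ≤ u x)
    (htouch : ∀ x, R < ‖x‖ → ¬ ∀ y, u x - u y ≤ κ * (w x - w y)) (x) : κ * w x ≤ u x := by
  by_contra! hx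
  have hlim : Tendsto (fun y => κ * w y) (cocompact _) (nhds 0) := by
    simpa using hwlim.const_mul κ
  obtain ⟨K, hK, hKsub⟩ := mem_cocompact.1 (hlim.eventually
    (gt_mem_nhds (show 0 < κ * w x - u x by linarith)))
  have hout : ∀ y ∉ K, κ * w y < κ * w x - u x := fun y hy => hKsub hy
  have hlsc' : LowerSemicontinuous fun y => u y + -(κ * w y) :=
    hlsc.add (by fun_prop : Continuous fun y => -(κ * w y)).lowerSemicontinuous
  have hxK : x ∈ K := by
    by_contra h
    linarith [hout x h, hpos x]
  obtain ⟨x₀, -, hmin⟩ := (hlsc'.lowerSemicontinuousOn K).exists_isMinOn ⟨x, hxK⟩ hK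
  have hmin' : ∀ y, u x₀ + -(κ * w x₀) ≤ u y + -(κ * w y) := by
    intro y
    by_cases hy : y ∈ K
    · exact hmin hy
    · have h1 : u x₀ + -(κ * w x₀) ≤ u x + -(κ * w x) := hmin hxK
      linarith [hout y hy, hpos y]
  refine htouch x₀ ?_ fun y => by linarith [hmin' y]
  by_contra! h
  linarith [hin x₀ h, hmin' x]

end

/-- Lower bound for positive supersolutions of `(-Δ_p)^s u ≥ 0` in an exterior domain:
`u(x) ≥ κ min{1, |x|^{-θ}}` for any `θ ∈ ((N-sp)/(p-1), N/(p-1))`. -/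
theorem stmt_8 (N : ℕ) (hN : 2 ≤ N) (s p : ℝ)
    (hs : 0 < s) (hs1 : s < 1) (hp : 1 < p)
    (hNsp : s * p < N)
    (Ω : Set (EuclideanSpace ℝ (Fin N))) (hΩo : IsOpen Ω)
    (hΩe : ∃ R : ℝ, 0 < R ∧ {x : EuclideanSpace ℝ (Fin N) | R ≤ ‖x‖} ⊆ Ω)
    (u : EuclideanSpace ℝ (Fin N) → ℝ)
    (hpos : ∀ x, 0 < u x) (hlsc : LowerSemicontinuous u)
    (L : EuclideanSpace ℝ (Fin N) → ℝ)
    (hpv : ∀ x ∈ Ω, pvFracPLap N s p u x (L x))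
    (hL : ∀ x ∈ Ω, 0 ≤ L x)
    (θ : ℝ) (hθ1 : ((N : ℝ) - s * p) / (p - 1) < θ) (hθ2 : θ < (N : ℝ) / (p - 1)) :
    ∃ κ : ℝ, 0 < κ ∧ ∀ x : EuclideanSpace ℝ (Fin N),
      κ * min 1 (‖x‖ ^ (-θ)) ≤ u x := by
  obtain ⟨R, -, hRΩ⟩ := hΩe
  have hcrit : (N : ℝ) - s * p < θ * (p - 1) := (div_lt_iff₀ (by linarith)).1 hθ1
  have hθ : 0 < θ := (div_pos (by linarith) (by linarith)).trans hθ1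
  obtain ⟨ρ₀, hneg⟩ := exists_neg_of_barrier_touching (by omega) hp hs hs1 hθ hNsp hcrit
  set w := fun y : EuclideanSpace ℝ (Fin N) => (max ‖y‖ 1) ^ (-θ)
  have hmax : ∀ y : EuclideanSpace ℝ (Fin N), 0 < max ‖y‖ 1 := fun y => by positivity
  have hw1 : ∀ y, w y ≤ 1 := fun y =>
    Real.rpow_le_one_of_one_le_of_nonpos (le_max_right _ _) (by linarith)
  have hwc : Continuous w :=
    (continuous_norm.max continuous_const).rpow_const fun y => Or.inl (hmax y).ne'
  have hwlim : Tendsto w (cocompact _) (nhds 0) :=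
    (tendsto_rpow_neg_atTop hθ).comp
      (tendsto_atTop_mono (fun y => le_max_left _ _) tendsto_norm_cocompact_atTop)
  set R' := max 0 (max R ρ₀)
  obtain ⟨x₁, -, hmin⟩ := (hlsc.lowerSemicontinuousOn _).exists_isMinOn
    (Metric.nonempty_closedBall.2 (le_max_left 0 (max R ρ₀)))
    (isCompact_closedBall (0 : EuclideanSpace ℝ (Fin N)) R')
  refine ⟨u x₁, hpos x₁, fun x => ?_⟩
  have hcomp := le_of_forall_touching (R := R') (κ := u x₁) hpos hlsc hwc hwlim
    (fun y hy => (mul_le_of_le_one_right (hpos x₁).le (hw1 y)).trans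
      (hmin (mem_closedBall_zero_iff.2 hy)))
    (fun y hy htouch => by
      have hyR : max R ρ₀ ≤ ‖y‖ := (le_max_right _ _).trans hy.le
      have hyΩ : y ∈ Ω := hRΩ ((le_max_left _ _).trans hyR)
      exact (hneg u y (u x₁) (L y) ((le_max_right _ _).trans hyR) (hpos x₁) htouch
        (hpv y hyΩ)).not_ge (hL y hyΩ)) x
  refine (mul_le_mul_of_nonneg_left ?_ (hpos x₁).le).trans hcomp
  rcases le_total ‖x‖ 1 with h | h
  · simp [w, max_eq_right h]
  · simp [w, max_eq_left h]
end

section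
/- Let N ≥ 2, 0 < s < 1 < p, N > sp, and let t, m ≥ 0 satisfy condition (M) and t(N − sp) + m(N − (sp − p + 1)) < N(p − 1). Let Ω ⊆ ℝ^N be an exterior domain and let u : ℝ^N → (0, ∞) be lower semicontinuous and differentiable at every point of Ω, and suppose that for every x ∈ Ω the fractional p-Laplacian (−Δ_p)^s u(x) exists in the principal-value sense with a value L(x) ≥ u(x)^t · ‖∇u(x)‖^m. Then for every θ ∈ (0, N/(p−1)) there exists a constant C > 0 such that u(x) ≥ C |x|^{−θ} for every x in the closure of Ω with |x| ≥ 1. -/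
open MeasureTheory Filter Set

theorem abs_det_inversion {N : ℕ} (w : EuclideanSpace ℝ (Fin N)) (c : ℝ) (hc : 0 ≤ c) :
    |((c • ((ℝ ∙ w)ᗮ.reflection : EuclideanSpace ℝ (Fin N) →L[ℝ] EuclideanSpace ℝ (Fin N))).det)|
      = c ^ N := by
  have h2 : |LinearMap.det ((ℝ ∙ w)ᗮ.reflection).toLinearMap| = 1 := by
    rw [Submodule.det_reflection]; simp
  rw [ContinuousLinearMap.det, ContinuousLinearMap.toLinearMap_smul, LinearMap.det_smul, abs_mul]
  erw [h2]
  simp [abs_of_nonneg, hc]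

/-- The odd power `a ↦ |a|^{p-2} a`. -/
noncomputable def oddPow (p a : ℝ) : ℝ := |a| ^ (p - 2) * a

theorem oddPow_of_nonneg {p a : ℝ} (hp : 1 < p) (ha : 0 ≤ a) : oddPow p a = a ^ (p - 1) := by
  unfold oddPow
  rcases ha.eq_or_lt with rfl | h
  · rw [Real.zero_rpow (by linarith : p - 1 ≠ 0), mul_zero]
  · rw [abs_of_pos h, show p - 1 = (p - 2) + 1 by ring, Real.rpow_add_one h.ne']

theorem oddPow_neg (p a : ℝ) : oddPow p (-a) = -oddPow p a := by
  simp [oddPow]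

theorem oddPow_mul {p c : ℝ} (a : ℝ) (hc : 0 < c) :
    oddPow p (c * a) = c ^ (p - 1) * oddPow p a := by
  unfold oddPow
  rw [abs_mul, abs_of_pos hc, Real.mul_rpow hc.le (abs_nonneg _),
    show p - 1 = (p - 2) + 1 by ring, Real.rpow_add_one hc.ne']
  ring

theorem oddPow_mono {p : ℝ} (hp : 1 < p) : Monotone (oddPow p) := by
  intro a b hab
  have key : ∀ x y : ℝ, 0 ≤ x → x ≤ y → oddPow p x ≤ oddPow p y := fun x y hx hxy => by
    rw [oddPow_of_nonneg hp hx, oddPow_of_nonneg hp (hx.trans hxy)]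
    exact Real.rpow_le_rpow hx hxy (by linarith)
  have nn : ∀ x : ℝ, 0 ≤ x → 0 ≤ oddPow p x := fun x hx => by
    rw [oddPow_of_nonneg hp hx]; positivity
  rcases le_total 0 a with ha | ha
  · exact key a b ha hab
  · have h1 := oddPow_neg p a
    rcases le_total 0 b with hb | hb
    · have := nn (-a) (by linarith)
      have := nn b hb
      linarith
    · have := key (-b) (-a) (by linarith) (by linarith)
      have := oddPow_neg p b
      linarith

theorem integrable_radial {N : ℕ} (hN : 2 ≤ N) {q d : ℝ} (hq : -(N : ℝ) < q) (hd : (N : ℝ) < d) :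
    Integrable (fun v : EuclideanSpace ℝ (Fin N) =>
      if ‖v‖ ≤ 1 then ‖v‖ ^ q else ‖v‖ ^ (-d)) := by
  have : Nontrivial (EuclideanSpace ℝ (Fin N)) := by
    apply Module.nontrivial_of_finrank_pos (R := ℝ)
    simp; omega
  refine (integrable_fun_norm_addHaar (E := EuclideanSpace ℝ (Fin N)) volume
    (f := fun ρ : ℝ => if ρ ≤ 1 then ρ ^ q else ρ ^ (-d))).2 ?_
  rw [finrank_euclideanSpace_fin, ← Ioc_union_Ioi_eq_Ioi (zero_le_one' ℝ)]
  have hcast : ((N - 1 : ℕ) : ℝ) = N - 1 := by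
    rw [Nat.cast_sub (by omega)]; simp
  refine IntegrableOn.union ?_ ?_
  · have h := (intervalIntegrable_iff_integrableOn_Ioc_of_le (zero_le_one' ℝ)).1
      (intervalIntegral.intervalIntegrable_rpow' (a := 0) (b := 1) (r := q + (N - 1))
        (by linarith))
    refine h.congr_fun ?_ measurableSet_Ioc
    intro y hy
    simp only [hy.2, if_true, smul_eq_mul]
    rw [Real.rpow_add hy.1, ← Real.rpow_natCast, hcast, mul_comm]
  · have h := integrableOn_Ioi_rpow_of_lt (a := -d + (N - 1)) (by linarith) one_pos
    refine h.congr_fun ?_ measurableSet_Ioi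
    intro y hy
    have hy' : (1 : ℝ) < y := hy
    simp only [not_le.2 hy', if_false, smul_eq_mul]
    rw [Real.rpow_add (by linarith), ← Real.rpow_natCast, hcast, mul_comm]

/-- Tails of the kernel are integrable. -/
theorem integrableOn_kernel {N : ℕ} (hN : 2 ≤ N) {d r : ℝ} (hd : (N : ℝ) < d) (hr : 0 < r)
    (e : EuclideanSpace ℝ (Fin N)) :
    IntegrableOn (fun z => ‖e - z‖ ^ (-d)) {z | r < ‖e - z‖} := by
  have h := (integrable_radial hN (q := 0) (by simp; omega) hd).comp_sub_left e
  have hm : MeasurableSet {z : EuclideanSpace ℝ (Fin N) | r < ‖e - z‖} :=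
    measurableSet_lt measurable_const (by fun_prop)
  refine Integrable.mono' ((h.const_mul (max 1 (r ^ (-d)))).integrableOn
    (s := {z | r < ‖e - z‖})) ?_ ?_
  · exact (Measurable.pow_const (by fun_prop) _).aestronglyMeasurable
  · refine (ae_restrict_iff' hm).2 (ae_of_all _ fun z (hz : r < ‖e - z‖) => ?_)
    rw [Real.norm_of_nonneg (by positivity)]
    split_ifs with h1
    · rw [Real.rpow_zero, mul_one]
      exact le_max_of_le_right (Real.rpow_le_rpow_of_nonpos hr hz.le
        (by have : (0 : ℝ) ≤ N := by positivity
            linarith))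
    · exact le_mul_of_one_le_left (by positivity) (le_max_left _ _)

/-- Inversion in the unit sphere turns the inner part of the integral into an outer one. -/
theorem integral_inner_eq {N : ℕ} {s p θ η r : ℝ} (hp : 1 < p) (hθ : 0 < θ) (hη : 0 < η)
    (e : EuclideanSpace ℝ (Fin N)) (he : ‖e‖ = 1) :
    ∫ z in {z : EuclideanSpace ℝ (Fin N) | η ≤ ‖z‖ ∧ ‖z‖ < 1 ∧ r < ‖e - z‖},
        oddPow p (1 - ‖z‖ ^ (-θ)) * ‖e - z‖ ^ (-((N : ℝ) + s * p)) =
      -∫ w in {w : EuclideanSpace ℝ (Fin N) | 1 < ‖w‖ ∧ ‖w‖ ≤ 1 / η ∧ r * ‖w‖ < ‖e - w‖},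
        (1 - ‖w‖ ^ (-θ)) ^ (p - 1) * ‖w‖ ^ (θ * (p - 1) - (N - s * p)) *
          ‖e - w‖ ^ (-((N : ℝ) + s * p)) := by
  set S : Set (EuclideanSpace ℝ (Fin N)) := {w | 1 < ‖w‖ ∧ ‖w‖ ≤ 1 / η ∧ r * ‖w‖ < ‖e - w‖} with hS
  set ι : EuclideanSpace ℝ (Fin N) → EuclideanSpace ℝ (Fin N) := EuclideanGeometry.inversion 0 1 with hι
  have e0 : e ≠ 0 := by rintro rfl; simp at he
  have hιn : ∀ w : EuclideanSpace ℝ (Fin N), ‖ι w‖ = 1 / ‖w‖ := fun w => by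
    have := EuclideanGeometry.dist_inversion_center (0 : EuclideanSpace ℝ (Fin N)) w 1
    simpa using this
  have hιe : ι e = e := by
    apply EuclideanGeometry.inversion_of_mem_sphere; simpa using he
  have hιd : ∀ w : EuclideanSpace ℝ (Fin N), w ≠ 0 → ‖e - ι w‖ = ‖e - w‖ / ‖w‖ := fun w hw => by
    have := EuclideanGeometry.dist_inversion_inversion e0 hw 1
    rw [show EuclideanGeometry.inversion (0 : EuclideanSpace ℝ (Fin N)) 1 e = e from hιe] at this
    simp only [dist_eq_norm, sub_zero, he, one_mul, one_pow] at this
    rw [hι, this]; ring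
  have hιι : ∀ w, ι (ι w) = w := EuclideanGeometry.inversion_inversion _ one_ne_zero
  have himg : {z : EuclideanSpace ℝ (Fin N) | η ≤ ‖z‖ ∧ ‖z‖ < 1 ∧ r < ‖e - z‖} = ι '' S := by
    ext z
    constructor
    · rintro ⟨h1, h2, h3⟩
      have hz : 0 < ‖z‖ := hη.trans_le h1
      refine ⟨ι z, ⟨?_, ?_, ?_⟩, hιι z⟩
      · rw [hιn]; exact (one_lt_div hz).2 h2
      · rw [hιn]; exact one_div_le_one_div_of_le hη h1
      · rw [hιn, hιd z (norm_pos_iff.1 hz), mul_one_div]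
        exact div_lt_div_of_pos_right h3 hz
    · rintro ⟨w, ⟨h1, h2, h3⟩, rfl⟩
      have hw : 0 < ‖w‖ := by linarith
      refine ⟨?_, ?_, ?_⟩
      · rw [hιn, le_div_iff₀ hw]
        rw [le_div_iff₀ hη] at h2; linarith
      · rw [hιn]; exact (div_lt_one hw).2 h1
      · rw [hιd w (norm_pos_iff.1 hw), lt_div_iff₀ hw]; exact h3
  have hSm : MeasurableSet S := by
    refine (measurableSet_lt measurable_const measurable_norm).inter
      ((measurableSet_le measurable_norm measurable_const).inter
        (measurableSet_lt (measurable_norm.const_mul r)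
          (measurable_const.sub measurable_id).norm))
  rw [himg, integral_image_eq_integral_abs_det_fderiv_smul volume hSm
    (f' := fun w => (1 / dist w 0) ^ 2 • ((ℝ ∙ (w - 0))ᗮ.reflection : EuclideanSpace ℝ (Fin N) →L[ℝ] EuclideanSpace ℝ (Fin N)))
    (fun w hw => (EuclideanGeometry.hasFDerivAt_inversion (by
      rintro rfl; have := hw.1; simp at this; linarith)).hasFDerivWithinAt)
    (EuclideanGeometry.inversion_injective _ one_ne_zero).injOn, ← integral_neg]
  refine setIntegral_congr_fun hSm ?_
  intro w hw
  have h1 : 1 < ‖w‖ := hw.1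
  have hw0 : 0 < ‖w‖ := by linarith
  simp only
  rw [abs_det_inversion _ _ (by positivity), hιn, hιd w (norm_pos_iff.1 hw0), dist_zero_right,
    smul_eq_mul, one_div, Real.inv_rpow hw0.le, Real.rpow_neg hw0.le, inv_inv]
  have hge : 1 ≤ ‖w‖ ^ θ := Real.one_le_rpow h1.le hθ.le
  rw [show 1 - ‖w‖ ^ θ = -(‖w‖ ^ θ * (1 - (‖w‖ ^ θ)⁻¹)) by field_simp; ring, oddPow_neg,
    oddPow_mul _ (by linarith), oddPow_of_nonneg hp (by
      have := inv_le_one_of_one_le₀ hge; linarith), Real.div_rpow (norm_nonneg _) hw0.le,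
    ← Real.rpow_mul hw0.le, ← pow_mul, ← Real.rpow_natCast, Real.inv_rpow hw0.le,
    ← Real.rpow_neg hw0.le, Real.rpow_neg hw0.le ((N : ℝ) + s * p), div_inv_eq_mul]
  have : ‖w‖ ^ (θ * (p - 1) - (N - s * p)) =
      ‖w‖ ^ (-(((2 * N : ℕ) : ℝ))) * ‖w‖ ^ (θ * (p - 1)) * ‖w‖ ^ ((N : ℝ) + s * p) := by
    rw [← Real.rpow_add hw0, ← Real.rpow_add hw0]
    congr 1; push_cast; ring
  rw [this]; ring

theorem one_sub_rpow_neg_mem {x θ : ℝ} (hx : 1 < x) (hθ : 0 < θ) :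
    0 ≤ 1 - x ^ (-θ) ∧ 1 - x ^ (-θ) ≤ 1 ∧ 1 - x ^ (-θ) ≤ θ * (x - 1) := by
  have hx0 : 0 < x := by linarith
  refine ⟨?_, ?_, ?_⟩
  · have := Real.rpow_le_one_of_one_le_of_nonpos hx.le (neg_nonpos.2 hθ.le)
    linarith
  · have := Real.rpow_nonneg hx0.le (-θ)
    linarith
  · rw [Real.rpow_def_of_pos hx0]
    have h1 := Real.add_one_le_exp (Real.log x * -θ)
    have h2 := mul_le_mul_of_nonneg_left (Real.log_le_sub_one_of_pos hx0) hθ.le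
    linarith

theorem one_sub_rpow_pow_mem {x θ p : ℝ} (hp : 1 < p) (hx : 1 < x) (hθ : 0 < θ) :
    0 ≤ (1 - x ^ (-θ)) ^ (p - 1) ∧ (1 - x ^ (-θ)) ^ (p - 1) ≤ 1 := by
  obtain ⟨h0, h1, -⟩ := one_sub_rpow_neg_mem hx hθ
  exact ⟨by positivity, Real.rpow_le_one h0 h1 (by linarith)⟩

theorem norm_sub_one_le {N : ℕ} {e : EuclideanSpace ℝ (Fin N)} (he : ‖e‖ = 1)
    (w : EuclideanSpace ℝ (Fin N)) : ‖w‖ - 1 ≤ ‖e - w‖ := by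
  rw [← he, norm_sub_rev]; exact norm_sub_norm_le w e

/-- The thin shell on which the ball and its inversion differ contributes little. -/
theorem integral_shell_le {N : ℕ} {s p θ : ℝ} (hp : 1 < p) (hs : 0 < s) (hθ : 0 < θ) :
    ∃ C : ℝ, ∀ e : EuclideanSpace ℝ (Fin N), ‖e‖ = 1 → ∀ r : ℝ, 0 < r → r < 1 / 2 → ∀ M : ℝ,
      ∫ w in {w : EuclideanSpace ℝ (Fin N) |
          1 < ‖w‖ ∧ ‖w‖ ≤ M ∧ r < ‖e - w‖ ∧ ‖e - w‖ ≤ r * ‖w‖},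
        (1 - ‖w‖ ^ (-θ)) ^ (p - 1) * ‖e - w‖ ^ (-((N : ℝ) + s * p)) ≤ C * r ^ (p - s * p) := by
  set V := volume.real (Metric.ball (0 : EuclideanSpace ℝ (Fin N)) 1) with hV
  refine ⟨(2 * θ) ^ (p - 1) * (N * 2 ^ N * V), fun e he r hr hr2 M => ?_⟩
  set S := {w : EuclideanSpace ℝ (Fin N) |
          1 < ‖w‖ ∧ ‖w‖ ≤ M ∧ r < ‖e - w‖ ∧ ‖e - w‖ ≤ r * ‖w‖} with hS
  have hd : -((N : ℝ) + s * p) ≤ 0 := by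
    have : 0 < s * p := by positivity
    have : (0 : ℝ) ≤ N := by positivity
    linarith
  have hle : ∀ w ∈ S, ‖e - w‖ ≤ r / (1 - r) := by
    rintro w ⟨-, -, -, h⟩
    have h1 := norm_sub_one_le he w
    rw [le_div_iff₀ (by linarith)]
    nlinarith
  have hr' : r / (1 - r) ≤ 2 * r := by
    rw [div_le_iff₀ (by linarith)]; nlinarith
  have hrr : r ≤ r / (1 - r) := by
    rw [le_div_iff₀ (by linarith)]; nlinarith
  have hsub : S ⊆ Metric.closedBall e (r / (1 - r)) \ Metric.closedBall e r := by
    intro w hw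
    refine ⟨?_, ?_⟩
    · rw [Metric.mem_closedBall, dist_comm, dist_eq_norm]; exact hle w hw
    · rw [Metric.mem_closedBall, dist_comm, dist_eq_norm, not_le]; exact hw.2.2.1
  have hvol : volume.real S ≤ V * (r ^ N * (N * r * 2 ^ N)) := by
    have hfin : volume (Metric.closedBall e (r / (1 - r))) ≠ ⊤ :=
      measure_closedBall_lt_top.ne
    refine (measureReal_mono hsub (measure_ne_top_of_subset sdiff_subset hfin)).trans ?_
    rw [measureReal_sdiff (Metric.closedBall_subset_closedBall hrr)
      Metric.isClosed_closedBall.measurableSet hfin]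
    rw [measureReal_def, measureReal_def, Measure.addHaar_closedBall _ _ (hr.le.trans hrr),
      Measure.addHaar_closedBall _ _ hr.le, ENNReal.toReal_mul, ENNReal.toReal_mul,
      finrank_euclideanSpace_fin, ENNReal.toReal_ofReal (pow_nonneg (hr.le.trans hrr) _),
      ENNReal.toReal_ofReal (by positivity), ← measureReal_def, ← hV, ← sub_mul, mul_comm]
    refine mul_le_mul_of_nonneg_left ?_ measureReal_nonneg
    have hb := one_add_mul_le_pow (a := -r) (by linarith) N
    have h1r : 0 < (1 - r) ^ N := pow_pos (by linarith) N
    have h2 : 1 ≤ 2 ^ N * (1 - r) ^ N := by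
      rw [← mul_pow]; exact one_le_pow₀ (by linarith)
    rw [div_pow, show r ^ N / (1 - r) ^ N - r ^ N = r ^ N * ((1 - (1 - r) ^ N) / (1 - r) ^ N) by
      field_simp]
    refine mul_le_mul_of_nonneg_left ?_ (by positivity)
    rw [div_le_iff₀ h1r]
    have h3 : 1 - (1 - r) ^ N ≤ N * r := by
      rw [sub_eq_add_neg 1 r]; linarith
    calc 1 - (1 - r) ^ N ≤ N * r * 1 := by linarith
      _ ≤ N * r * (2 ^ N * (1 - r) ^ N) := mul_le_mul_of_nonneg_left h2 (by positivity)
      _ = _ := by ring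
  have hfin : volume S < ⊤ := (measure_mono hsub).trans_lt
    ((measure_mono sdiff_subset).trans_lt measure_closedBall_lt_top)
  have hbd : ∀ w ∈ S, ‖(1 - ‖w‖ ^ (-θ)) ^ (p - 1) * ‖e - w‖ ^ (-((N : ℝ) + s * p))‖ ≤
      (2 * θ * r) ^ (p - 1) * r ^ (-((N : ℝ) + s * p)) := by
    intro w hw
    obtain ⟨h0, h1, h2⟩ := one_sub_rpow_neg_mem hw.1 hθ
    rw [Real.norm_of_nonneg (by positivity)]
    refine mul_le_mul (Real.rpow_le_rpow h0 (h2.trans ?_) (by linarith))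
      (Real.rpow_le_rpow_of_nonpos hr hw.2.2.1.le hd) (by positivity) (by positivity)
    have := norm_sub_one_le he w
    have := hle w hw
    nlinarith
  have := (le_abs_self _).trans (norm_setIntegral_le_of_norm_le_const hfin hbd)
  refine this.trans ((mul_le_mul_of_nonneg_left hvol (by positivity)).trans (le_of_eq ?_))
  rw [Real.mul_rpow (by positivity) hr.le, show p - s * p = (p - 1) + -((N : ℝ) + s * p) + N + 1 by
    ring, Real.rpow_add_one hr.ne', Real.rpow_add hr, Real.rpow_add hr, Real.rpow_natCast]
  ring

/-- Contribution of far away points. -/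
theorem integral_tail_le {N : ℕ} (hN : 2 ≤ N) {s p θ : ℝ} (hp : 1 < p) (hs : 0 < s)
    (hθ : 0 < θ) :
    ∃ K : ℝ, 0 ≤ K ∧ ∀ e : EuclideanSpace ℝ (Fin N), ‖e‖ = 1 → ∀ r : ℝ, ∀ M : ℝ, 2 ≤ M →
      ∫ w in {w : EuclideanSpace ℝ (Fin N) | M < ‖w‖ ∧ r < ‖e - w‖},
        (1 - ‖w‖ ^ (-θ)) ^ (p - 1) * ‖e - w‖ ^ (-((N : ℝ) + s * p)) ≤
          K * (M - 1) ^ (-(s * p / 2)) := by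
  have hsp : 0 < s * p := by positivity
  have hN0 : (0 : ℝ) < N := by positivity
  have hd : (N : ℝ) < N + s * p / 2 := by linarith
  set g : EuclideanSpace ℝ (Fin N) → ℝ :=
    fun v => if ‖v‖ ≤ 1 then ‖v‖ ^ (0 : ℝ) else ‖v‖ ^ (-((N : ℝ) + s * p / 2)) with hg
  have hgi : Integrable g := integrable_radial hN (by linarith) hd
  have hg0 : ∀ v, 0 ≤ g v := fun v => by simp only [hg]; split_ifs <;> positivity
  refine ⟨∫ v, g v, integral_nonneg hg0, fun e he r M hM => ?_⟩
  have hm : MeasurableSet {w : EuclideanSpace ℝ (Fin N) | M < ‖w‖ ∧ r < ‖e - w‖} :=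
    (measurableSet_lt measurable_const measurable_norm).inter
      (measurableSet_lt measurable_const (measurable_const.sub measurable_id).norm)
  have hgi' : Integrable (fun w => g (e - w) * (M - 1) ^ (-(s * p / 2))) :=
    (hgi.comp_sub_left e).mul_const _
  have hpt : ∀ w ∈ {w : EuclideanSpace ℝ (Fin N) | M < ‖w‖ ∧ r < ‖e - w‖},
      0 ≤ (1 - ‖w‖ ^ (-θ)) ^ (p - 1) * ‖e - w‖ ^ (-((N : ℝ) + s * p)) ∧
      (1 - ‖w‖ ^ (-θ)) ^ (p - 1) * ‖e - w‖ ^ (-((N : ℝ) + s * p)) ≤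
        g (e - w) * (M - 1) ^ (-(s * p / 2)) := by
    rintro w ⟨hw, -⟩
    have h1 := norm_sub_one_le he w
    have hpos : 0 < ‖e - w‖ := by linarith
    obtain ⟨h2, h3⟩ := one_sub_rpow_pow_mem hp (by linarith : 1 < ‖w‖) hθ
    refine ⟨by positivity, (mul_le_of_le_one_left (by positivity) h3).trans ?_⟩
    simp only [hg, not_le.2 (by linarith : 1 < ‖e - w‖), if_false]
    rw [show -((N : ℝ) + s * p) = -((N : ℝ) + s * p / 2) + -(s * p / 2) by ring,
      Real.rpow_add hpos]
    exact mul_le_mul_of_nonneg_left (Real.rpow_le_rpow_of_nonpos (by linarith) (by linarith)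
      (by linarith)) (by positivity)
  have e1 : ∫ v, g v = ∫ w, g (e - w) := (integral_sub_left_eq_self g volume e).symm
  rw [e1, ← integral_mul_const]
  refine le_trans (integral_mono_of_nonneg ?_ hgi'.integrableOn ?_)
    (setIntegral_le_integral hgi' (ae_of_all _ fun w => ?_))
  · exact (ae_restrict_iff' hm).2 (ae_of_all _ fun w hw => (hpt w hw).1)
  · exact (ae_restrict_iff' hm).2 (ae_of_all _ fun w hw => (hpt w hw).2)
  · have : 0 ≤ (M - 1) ^ (-(s * p / 2)) := Real.rpow_nonneg (by linarith) _
    exact mul_nonneg (hg0 _) this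

/-- Upper bound for the symmetrised core of the integral, valid for every exponent. -/
theorem integral_core_le {N : ℕ} (hN : 2 ≤ N) {s p θ : ℝ} (hp : 1 < p) (hs : 0 < s) (hs1 : s < 1)
    (hNsp : s * p < N) (hθ : 0 < θ) :
    ∃ K : ℝ, ∀ e : EuclideanSpace ℝ (Fin N), ‖e‖ = 1 → ∀ S : Set (EuclideanSpace ℝ (Fin N)),
      MeasurableSet S → (∀ w ∈ S, 1 < ‖w‖) →
      IntegrableOn (fun w => (1 - ‖w‖ ^ (-θ)) ^ (p - 1) *
        (1 - ‖w‖ ^ (θ * (p - 1) - (N - s * p))) * ‖e - w‖ ^ (-((N : ℝ) + s * p))) S →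
      ∫ w in S, (1 - ‖w‖ ^ (-θ)) ^ (p - 1) *
        (1 - ‖w‖ ^ (θ * (p - 1) - (N - s * p))) * ‖e - w‖ ^ (-((N : ℝ) + s * p)) ≤ K := by
  have hsp : 0 < s * p := by positivity
  have hN0 : (0 : ℝ) < N := by positivity
  have hq : -(N : ℝ) < p - (N + s * p) := by nlinarith
  set b : ℝ := N - s * p with hb
  have hb0 : 0 < b := by linarith
  set g : EuclideanSpace ℝ (Fin N) → ℝ :=
    fun v => if ‖v‖ ≤ 1 then ‖v‖ ^ (p - (N + s * p)) else ‖v‖ ^ (-((N : ℝ) + s * p)) with hg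
  have hgi : Integrable g := integrable_radial hN hq (by linarith)
  have hg0 : ∀ v, 0 ≤ g v := fun v => by simp only [hg]; split_ifs <;> positivity
  set C := max 1 (θ ^ (p - 1) * b) with hC
  have hC0 : 0 ≤ C := le_max_of_le_left zero_le_one
  refine ⟨∫ v, C * g v, fun e he S hS hS1 hint => ?_⟩
  have hgi' : Integrable (fun w => C * g (e - w)) := (hgi.comp_sub_left e).const_mul _
  have e1 : ∫ v, C * g v = ∫ w, C * g (e - w) :=
    (integral_sub_left_eq_self (fun v => C * g v) volume e).symm
  rw [e1]
  refine (setIntegral_mono_on hint hgi'.integrableOn hS fun w hw => ?_).trans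
    (setIntegral_le_integral hgi' (ae_of_all _ fun w => mul_nonneg hC0 (hg0 _)))
  have hw1 := hS1 w hw
  have h1 := norm_sub_one_le he w
  have hpos : 0 < ‖e - w‖ := by linarith
  obtain ⟨p0, p1⟩ := one_sub_rpow_pow_mem hp hw1 hθ
  obtain ⟨t0, t1, t2⟩ := one_sub_rpow_neg_mem hw1 hθ
  obtain ⟨b0, b1, b2⟩ := one_sub_rpow_neg_mem hw1 hb0
  have hab : 1 - ‖w‖ ^ (θ * (p - 1) - b) ≤ 1 - ‖w‖ ^ (-b) := by
    have := Real.rpow_le_rpow_of_exponent_le hw1.le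
      (show -b ≤ θ * (p - 1) - b by nlinarith)
    linarith
  calc (1 - ‖w‖ ^ (-θ)) ^ (p - 1) * (1 - ‖w‖ ^ (θ * (p - 1) - b)) *
        ‖e - w‖ ^ (-((N : ℝ) + s * p))
      ≤ (1 - ‖w‖ ^ (-θ)) ^ (p - 1) * (1 - ‖w‖ ^ (-b)) * ‖e - w‖ ^ (-((N : ℝ) + s * p)) := by
        gcongr
    _ ≤ C * g (e - w) := ?_
  simp only [hg]
  split_ifs with hv
  · calc (1 - ‖w‖ ^ (-θ)) ^ (p - 1) * (1 - ‖w‖ ^ (-b)) * ‖e - w‖ ^ (-((N : ℝ) + s * p))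
        ≤ (θ * ‖e - w‖) ^ (p - 1) * (b * ‖e - w‖) * ‖e - w‖ ^ (-((N : ℝ) + s * p)) := by
          refine mul_le_mul_of_nonneg_right (mul_le_mul (Real.rpow_le_rpow t0 (t2.trans
            (mul_le_mul_of_nonneg_left h1 hθ.le)) (by linarith)) (b2.trans
            (mul_le_mul_of_nonneg_left h1 hb0.le)) b0 (by positivity)) (by positivity)
      _ = (θ ^ (p - 1) * b) * ‖e - w‖ ^ (p - (N + s * p)) := by
          rw [Real.mul_rpow hθ.le hpos.le, show p - (N + s * p) = (p - 1) + 1 + -(N + s * p) by ring,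
            Real.rpow_add hpos, Real.rpow_add_one hpos.ne']
          ring
      _ ≤ _ := mul_le_mul_of_nonneg_right (le_max_right _ _) (by positivity)
  · refine mul_le_mul_of_nonneg_right ?_ (by positivity)
    exact (mul_le_one₀ p1 b0 b1).trans (le_max_left _ _)

/-- For exponents beyond the critical one the symmetrised core of the integral is negative. -/
theorem integral_core_neg {N : ℕ} {s p θ : ℝ} (hp : 1 < p) (hs : 0 < s)
    (hθ : 0 < θ) (hcrit : (N : ℝ) - s * p < θ * (p - 1)) :
    ∃ κ : ℝ, 0 < κ ∧ ∀ e : EuclideanSpace ℝ (Fin N), ‖e‖ = 1 →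
      ∀ S : Set (EuclideanSpace ℝ (Fin N)),
      MeasurableSet S → (∀ w ∈ S, 1 < ‖w‖) → Metric.ball ((2 : ℝ) • e) (1 / 2) ⊆ S →
      IntegrableOn (fun w => (1 - ‖w‖ ^ (-θ)) ^ (p - 1) *
        (1 - ‖w‖ ^ (θ * (p - 1) - (N - s * p))) * ‖e - w‖ ^ (-((N : ℝ) + s * p))) S →
      ∫ w in S, (1 - ‖w‖ ^ (-θ)) ^ (p - 1) *
        (1 - ‖w‖ ^ (θ * (p - 1) - (N - s * p))) * ‖e - w‖ ^ (-((N : ℝ) + s * p)) ≤ -κ := by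
  have hsp : 0 < s * p := by positivity
  have hN0 : (0 : ℝ) ≤ N := by positivity
  set α : ℝ := θ * (p - 1) - (N - s * p) with hα
  have hα0 : 0 < α := by linarith
  have c1 : 0 < (1 - (3 / 2 : ℝ) ^ (-θ)) ^ (p - 1) := by
    have := Real.rpow_lt_one_of_one_lt_of_neg (by norm_num : (1 : ℝ) < 3 / 2) (neg_neg_of_pos hθ)
    exact Real.rpow_pos_of_pos (by linarith) _
  have c2 : 0 < (3 / 2 : ℝ) ^ α - 1 := by
    have := Real.one_lt_rpow (by norm_num : (1 : ℝ) < 3 / 2) hα0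
    linarith
  have c3 : (0 : ℝ) < (3 / 2) ^ (-((N : ℝ) + s * p)) := by positivity
  set c := (1 - (3 / 2 : ℝ) ^ (-θ)) ^ (p - 1) * ((3 / 2 : ℝ) ^ α - 1) *
    (3 / 2) ^ (-((N : ℝ) + s * p)) with hc
  have hc0 : 0 < c := by positivity
  have hv : 0 < volume.real (Metric.ball (0 : EuclideanSpace ℝ (Fin N)) (1 / 2)) :=
    ENNReal.toReal_pos (Metric.measure_ball_pos _ _ (by norm_num)).ne' measure_ball_lt_top.ne
  refine ⟨c * volume.real (Metric.ball (0 : EuclideanSpace ℝ (Fin N)) (1 / 2)), by positivity,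
    fun e he S hS hS1 hB hint => ?_⟩
  set G : EuclideanSpace ℝ (Fin N) → ℝ := fun w => (1 - ‖w‖ ^ (-θ)) ^ (p - 1) *
        (1 - ‖w‖ ^ α) * ‖e - w‖ ^ (-((N : ℝ) + s * p)) with hG
  have hneg : ∀ w ∈ S, 0 ≤ -G w := fun w hw => by
    have hw1 := hS1 w hw
    have h1 := (one_sub_rpow_pow_mem hp hw1 hθ).1
    have h2 := Real.one_le_rpow hw1.le hα0.le
    have h3 : 0 ≤ ‖e - w‖ ^ (-((N : ℝ) + s * p)) := by positivity
    simp only [hG]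
    have := mul_nonneg (mul_nonneg h1 (sub_nonneg.2 h2)) h3
    linarith
  have hball : ∀ w ∈ Metric.ball ((2 : ℝ) • e) (1 / 2), c ≤ -G w := fun w hw => by
    have hw1 := hS1 w (hB hw)
    rw [Metric.mem_ball, dist_eq_norm] at hw
    have n2 : ‖(2 : ℝ) • e‖ = 2 := by rw [norm_smul, he]; norm_num
    have n1 : 3 / 2 ≤ ‖w‖ := by
      have := norm_sub_norm_le ((2 : ℝ) • e) w
      rw [norm_sub_rev] at hw
      linarith
    have n3 : ‖e - w‖ ≤ 3 / 2 := by
      have : e - w = -(w - (2 : ℝ) • e) - e := by rw [two_smul]; abel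
      rw [this]
      refine (norm_sub_le _ _).trans ?_
      rw [norm_neg, he]; linarith
    have n4 := norm_sub_one_le he w
    simp only [hG, hc]
    rw [show -((1 - ‖w‖ ^ (-θ)) ^ (p - 1) * (1 - ‖w‖ ^ α) * ‖e - w‖ ^ (-((N : ℝ) + s * p))) =
      (1 - ‖w‖ ^ (-θ)) ^ (p - 1) * (‖w‖ ^ α - 1) * ‖e - w‖ ^ (-((N : ℝ) + s * p)) by ring]
    have a1 : (1 - (3 / 2 : ℝ) ^ (-θ)) ^ (p - 1) ≤ (1 - ‖w‖ ^ (-θ)) ^ (p - 1) := by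
      refine Real.rpow_le_rpow ?_ ?_ (by linarith)
      · exact (one_sub_rpow_neg_mem (by norm_num) hθ).1
      · have := Real.rpow_le_rpow_of_nonpos (by norm_num : (0 : ℝ) < 3 / 2) n1
          (neg_nonpos.2 hθ.le)
        linarith
    have a2 : (3 / 2 : ℝ) ^ α ≤ ‖w‖ ^ α := Real.rpow_le_rpow (by norm_num) n1 hα0.le
    have a3 : (3 / 2 : ℝ) ^ (-((N : ℝ) + s * p)) ≤ ‖e - w‖ ^ (-((N : ℝ) + s * p)) :=
      Real.rpow_le_rpow_of_nonpos (by linarith) n3 (by linarith)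
    refine mul_le_mul (mul_le_mul a1 (by linarith) c2.le (c1.le.trans a1)) a3 c3.le ?_
    exact mul_nonneg (c1.le.trans a1) (by linarith)
  have hfin : volume (Metric.ball ((2 : ℝ) • e) (1 / 2)) ≠ ⊤ := measure_ball_lt_top.ne
  have hnint : IntegrableOn (fun w => -G w) S := hint.neg
  have step1 : c * volume.real (Metric.ball ((2 : ℝ) • e) (1 / 2)) ≤
      ∫ w in Metric.ball ((2 : ℝ) • e) (1 / 2), -G w :=
    setIntegral_ge_of_const_le_real Metric.isOpen_ball.measurableSet hfin hball (hnint.mono_set hB)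
  have step2 : ∫ w in Metric.ball ((2 : ℝ) • e) (1 / 2), -G w ≤ ∫ w in S, -G w :=
    setIntegral_mono_set hnint ((ae_restrict_iff' hS).2 (ae_of_all _ hneg)) hB.eventuallyLE
  have hn : ∫ w in S, -G w = -∫ w in S, G w := integral_neg _
  have hvol : volume.real (Metric.ball ((2 : ℝ) • e) (1 / 2)) =
      volume.real (Metric.ball (0 : EuclideanSpace ℝ (Fin N)) (1 / 2)) := by
    rw [measureReal_def, measureReal_def, Measure.addHaar_ball_center]
  rw [hvol] at step1
  have : ∫ w in S, G w ≤ -(c * volume.real (Metric.ball (0 : EuclideanSpace ℝ (Fin N)) (1 / 2))) := by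
    linarith
  exact this

/-- The normalised radial profile increment, cut off near the origin. -/
noncomputable def cutoffIncr {N : ℕ} (p θ η : ℝ) (z : EuclideanSpace ℝ (Fin N)) : ℝ :=
  if η ≤ ‖z‖ then oddPow p (1 - ‖z‖ ^ (-θ)) else 0

theorem measurable_oddPow (p : ℝ) : Measurable (oddPow p) :=
  ((continuous_abs.measurable).pow_const _).mul measurable_id

theorem measurable_cutoffIncr {N : ℕ} (p θ η : ℝ) :
    Measurable (cutoffIncr p θ η : EuclideanSpace ℝ (Fin N) → ℝ) := by
  refine Measurable.ite (measurableSet_le measurable_const measurable_norm) ?_ measurable_const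
  exact (measurable_oddPow p).comp (measurable_const.sub (measurable_norm.pow_const _))

theorem abs_cutoffIncr_le {N : ℕ} {p θ η : ℝ} (hp : 1 < p) (hθ : 0 < θ) (hη : 0 < η)
    (z : EuclideanSpace ℝ (Fin N)) :
    |cutoffIncr p θ η z| ≤ max (|oddPow p (1 - η ^ (-θ))|) |oddPow p 1| := by
  unfold cutoffIncr
  split_ifs with h
  · refine abs_le_max_abs_abs (oddPow_mono hp ?_) (oddPow_mono hp ?_)
    · have := Real.rpow_le_rpow_of_nonpos hη h (neg_nonpos.2 hθ.le)
      linarith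
    · have : 0 ≤ ‖z‖ ^ (-θ) := by positivity
      linarith
  · simp

theorem integrableOn_cutoffIncr_smul {N : ℕ} (hN : 2 ≤ N) {s p θ η r : ℝ} (hp : 1 < p) (hs : 0 < s)
    (hθ : 0 < θ) (hη : 0 < η) (hr : 0 < r) (x : EuclideanSpace ℝ (Fin N)) (c : ℝ) :
    IntegrableOn (fun z => cutoffIncr p θ η (c • z) * ‖x - z‖ ^ (-((N : ℝ) + s * p)))
      {z | r < ‖x - z‖} := by
  have hsp : 0 < s * p := by positivity
  exact Integrable.bdd_mul (integrableOn_kernel hN (d := (N : ℝ) + s * p) (by linarith) hr x)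
    ((measurable_cutoffIncr p θ η).comp (measurable_const_smul c)).aestronglyMeasurable
    (ae_of_all _ fun z => abs_cutoffIncr_le hp hθ hη _)

theorem integral_cutoffIncr_eq {N : ℕ} (hN : 2 ≤ N) {s p θ η r : ℝ} (hp : 1 < p) (hs : 0 < s)
    (hθ : 0 < θ) (hη : 0 < η) (hη1 : η ≤ 1) (hr : 0 < r)
    (e : EuclideanSpace ℝ (Fin N)) (he : ‖e‖ = 1) :
    IntegrableOn (fun w : EuclideanSpace ℝ (Fin N) => (1 - ‖w‖ ^ (-θ)) ^ (p - 1) *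
        (1 - ‖w‖ ^ (θ * (p - 1) - (N - s * p))) * ‖e - w‖ ^ (-((N : ℝ) + s * p)))
      {w | 1 < ‖w‖ ∧ ‖w‖ ≤ 1 / η ∧ r * ‖w‖ < ‖e - w‖} ∧
    ∫ z in {z | r < ‖e - z‖}, cutoffIncr p θ η z * ‖e - z‖ ^ (-((N : ℝ) + s * p)) =
      (∫ w in {w : EuclideanSpace ℝ (Fin N) | 1 < ‖w‖ ∧ ‖w‖ ≤ 1 / η ∧ r * ‖w‖ < ‖e - w‖},
        (1 - ‖w‖ ^ (-θ)) ^ (p - 1) *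
        (1 - ‖w‖ ^ (θ * (p - 1) - (N - s * p))) * ‖e - w‖ ^ (-((N : ℝ) + s * p))) +
      (∫ w in {w : EuclideanSpace ℝ (Fin N) |
          1 < ‖w‖ ∧ ‖w‖ ≤ 1 / η ∧ r < ‖e - w‖ ∧ ‖e - w‖ ≤ r * ‖w‖},
        (1 - ‖w‖ ^ (-θ)) ^ (p - 1) * ‖e - w‖ ^ (-((N : ℝ) + s * p))) +
      ∫ w in {w : EuclideanSpace ℝ (Fin N) | 1 / η < ‖w‖ ∧ r < ‖e - w‖},
        (1 - ‖w‖ ^ (-θ)) ^ (p - 1) * ‖e - w‖ ^ (-((N : ℝ) + s * p)) := by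
  have hsp : 0 < s * p := by positivity
  set F : EuclideanSpace ℝ (Fin N) → ℝ :=
    fun z => cutoffIncr p θ η z * ‖e - z‖ ^ (-((N : ℝ) + s * p)) with hF
  set D : Set (EuclideanSpace ℝ (Fin N)) := {z | r < ‖e - z‖} with hD
  have hFD : IntegrableOn F D := by
    have h := integrableOn_cutoffIncr_smul hN (s := s) hp hs hθ hη hr e 1
    simp only [one_smul] at h
    exact h
  set I : Set (EuclideanSpace ℝ (Fin N)) := {z | η ≤ ‖z‖ ∧ ‖z‖ < 1 ∧ r < ‖e - z‖} with hI
  set S : Set (EuclideanSpace ℝ (Fin N)) := {w | 1 < ‖w‖ ∧ ‖w‖ ≤ 1 / η ∧ r * ‖w‖ < ‖e - w‖}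
    with hS
  set Q : Set (EuclideanSpace ℝ (Fin N)) :=
    {w | 1 < ‖w‖ ∧ ‖w‖ ≤ 1 / η ∧ r < ‖e - w‖ ∧ ‖e - w‖ ≤ r * ‖w‖} with hQ
  set T : Set (EuclideanSpace ℝ (Fin N)) := {w | 1 / η < ‖w‖ ∧ r < ‖e - w‖} with hT
  have mn : Measurable fun z : EuclideanSpace ℝ (Fin N) => ‖z‖ := measurable_norm
  have me : Measurable fun z : EuclideanSpace ℝ (Fin N) => ‖e - z‖ :=
    (measurable_const.sub measurable_id).norm
  have mD : MeasurableSet D := measurableSet_lt measurable_const me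
  have mI : MeasurableSet I := (measurableSet_le measurable_const mn).inter
    ((measurableSet_lt mn measurable_const).inter mD)
  have mS : MeasurableSet S := (measurableSet_lt measurable_const mn).inter
    ((measurableSet_le mn measurable_const).inter (measurableSet_lt (mn.const_mul r) me))
  have mQ : MeasurableSet Q := (measurableSet_lt measurable_const mn).inter
    ((measurableSet_le mn measurable_const).inter
      (mD.inter (measurableSet_le me (mn.const_mul r))))
  have mT : MeasurableSet T := (measurableSet_lt measurable_const mn).inter mD
  have hη' : 1 ≤ 1 / η := (one_le_div hη).2 hη1
  have sI : I ⊆ D := fun z hz => hz.2.2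
  have sS : S ⊆ D := fun z hz => lt_trans (by nlinarith [hz.1]) hz.2.2
  have sQ : Q ⊆ D := fun z hz => hz.2.2.1
  have sT : T ⊆ D := fun z hz => hz.2
  have hsplit : D.indicator F = I.indicator F + S.indicator F + Q.indicator F + T.indicator F := by
    ext z
    simp only [Pi.add_apply]
    by_cases hzD : z ∈ D
    · rw [indicator_of_mem hzD]
      have hzr : r < ‖e - z‖ := hzD
      rcases lt_or_ge ‖z‖ η with h1 | h1
      · have : F z = 0 := by simp [hF, cutoffIncr, not_le.2 h1]
        simp [indicator_apply, this]
      rcases lt_trichotomy ‖z‖ 1 with h2 | h2 | h2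
      · have i1 : z ∈ I := ⟨h1, h2, hzr⟩
        have i2 : z ∉ S := fun h => by have := h.1; linarith
        have i3 : z ∉ Q := fun h => by have := h.1; linarith
        have i4 : z ∉ T := fun h => by have := h.1; linarith
        simp [i1, i2, i3, i4]
      · have : F z = 0 := by simp [hF, cutoffIncr, h2, oddPow]
        simp [indicator_apply, this]
      · have i1 : z ∉ I := fun h => by have := h.2.1; linarith
        rcases lt_or_ge (1 / η) ‖z‖ with h3 | h3
        · have i2 : z ∉ S := fun h => by have := h.2.1; linarith
          have i3 : z ∉ Q := fun h => by have := h.2.1; linarith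
          have i4 : z ∈ T := ⟨h3, hzr⟩
          simp [i1, i2, i3, i4]
        · have i4 : z ∉ T := fun h => by have := h.1; linarith
          rcases lt_or_ge (r * ‖z‖) ‖e - z‖ with h4 | h4
          · have i2 : z ∈ S := ⟨h2, h3, h4⟩
            have i3 : z ∉ Q := fun h => by have := h.2.2.2; linarith
            simp [i1, i2, i3, i4]
          · have i2 : z ∉ S := fun h => by have := h.2.2; linarith
            have i3 : z ∈ Q := ⟨h2, h3, hzr, h4⟩
            simp [i1, i2, i3, i4]
    · have i1 : z ∉ I := fun h => hzD (sI h)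
      have i2 : z ∉ S := fun h => hzD (sS h)
      have i3 : z ∉ Q := fun h => hzD (sQ h)
      have i4 : z ∉ T := fun h => hzD (sT h)
      simp [i1, i2, i3, i4, hzD]
  have jI := (integrable_indicator_iff mI).2 (hFD.mono_set sI)
  have jS := (integrable_indicator_iff mS).2 (hFD.mono_set sS)
  have jQ := (integrable_indicator_iff mQ).2 (hFD.mono_set sQ)
  have jT := (integrable_indicator_iff mT).2 (hFD.mono_set sT)
  have hsum : ∫ z in D, F z = (∫ z in I, F z) + (∫ z in S, F z) + (∫ z in Q, F z) +
      ∫ z in T, F z := by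
    rw [← integral_indicator mD, hsplit, integral_add' ((jI.add jS).add jQ) jT,
      integral_add' (jI.add jS) jQ, integral_add' jI jS, integral_indicator mI,
      integral_indicator mS, integral_indicator mQ, integral_indicator mT]
  have hout : ∀ w : EuclideanSpace ℝ (Fin N), 1 < ‖w‖ →
      F w = (1 - ‖w‖ ^ (-θ)) ^ (p - 1) * ‖e - w‖ ^ (-((N : ℝ) + s * p)) := fun w hw => by
    simp only [hF, cutoffIncr]
    rw [if_pos (hη1.trans hw.le), oddPow_of_nonneg hp (one_sub_rpow_neg_mem hw hθ).1]
  have hIeq : ∫ z in I, F z = -∫ w in S,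
        (1 - ‖w‖ ^ (-θ)) ^ (p - 1) * ‖w‖ ^ (θ * (p - 1) - (N - s * p)) *
          ‖e - w‖ ^ (-((N : ℝ) + s * p)) := by
    rw [← integral_inner_eq hp hθ hη e he]
    refine setIntegral_congr_fun mI fun z hz => ?_
    simp only [hF, cutoffIncr, if_pos hz.1]
  have hQeq : ∫ z in Q, F z = ∫ w in Q, (1 - ‖w‖ ^ (-θ)) ^ (p - 1) *
      ‖e - w‖ ^ (-((N : ℝ) + s * p)) := setIntegral_congr_fun mQ fun w hw => hout w hw.1
  have hTeq : ∫ z in T, F z = ∫ w in T, (1 - ‖w‖ ^ (-θ)) ^ (p - 1) *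
      ‖e - w‖ ^ (-((N : ℝ) + s * p)) :=
    setIntegral_congr_fun mT fun w hw => hout w (hη'.trans_lt hw.1)
  set α : ℝ := θ * (p - 1) - (N - s * p) with hα
  have hG2 : IntegrableOn (fun w => ‖w‖ ^ α * F w) S := by
    refine Integrable.bdd_mul (c := (1 / η) ^ |α|) (hFD.mono_set sS)
      (measurable_norm.pow_const _).aestronglyMeasurable
      ((ae_restrict_iff' mS).2 (ae_of_all _ fun w hw => ?_))
    rw [Real.norm_of_nonneg (by positivity)]
    exact (Real.rpow_le_rpow_of_exponent_le hw.1.le (le_abs_self α)).trans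
      (Real.rpow_le_rpow (by positivity) hw.2.1 (abs_nonneg _))
  have hG2' : ∫ w in S, (1 - ‖w‖ ^ (-θ)) ^ (p - 1) * ‖w‖ ^ α *
      ‖e - w‖ ^ (-((N : ℝ) + s * p)) = ∫ w in S, ‖w‖ ^ α * F w :=
    setIntegral_congr_fun mS fun w hw => by simp only [hout w hw.1]; ring
  have hcore : ∀ w ∈ S, F w - ‖w‖ ^ α * F w = (1 - ‖w‖ ^ (-θ)) ^ (p - 1) * (1 - ‖w‖ ^ α) *
      ‖e - w‖ ^ (-((N : ℝ) + s * p)) := fun w hw => by rw [hout w hw.1]; ring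
  refine ⟨(((hFD.mono_set sS).sub hG2).congr_fun hcore mS), ?_⟩
  rw [hsum, hIeq, hQeq, hTeq, hG2', ← setIntegral_congr_fun mS hcore,
    integral_sub (hFD.mono_set sS) hG2]
  ring

theorem measurableSet_core {N : ℕ} (e : EuclideanSpace ℝ (Fin N)) (r M : ℝ) :
    MeasurableSet {w : EuclideanSpace ℝ (Fin N) | 1 < ‖w‖ ∧ ‖w‖ ≤ M ∧ r * ‖w‖ < ‖e - w‖} :=
  (measurableSet_lt measurable_const measurable_norm).inter
    ((measurableSet_le measurable_norm measurable_const).inter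
      (measurableSet_lt (measurable_norm.const_mul r) (measurable_const.sub measurable_id).norm))

theorem cutoff_integral_bound {N : ℕ} (hN : 2 ≤ N) {s p θ : ℝ} (hp : 1 < p) (hs : 0 < s)
    (hs1 : s < 1) (hNsp : s * p < N) (hθ : 0 < θ) :
    ∃ κ η : ℝ, 0 < η ∧ η ≤ 1 ∧ ((N : ℝ) - s * p < θ * (p - 1) → κ < 0) ∧
      ∀ e : EuclideanSpace ℝ (Fin N), ‖e‖ = 1 → ∀ᶠ r in nhdsWithin (0 : ℝ) (Ioi 0),
        ∫ z in {z | r < ‖e - z‖}, cutoffIncr p θ η z * ‖e - z‖ ^ (-((N : ℝ) + s * p)) ≤ κ := by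
  have hsp : 0 < s * p := by positivity
  obtain ⟨C, hC⟩ := integral_shell_le (N := N) hp hs hθ
  obtain ⟨K, hK0, hK⟩ := integral_tail_le hN hp hs hθ
  have hsmall : ∀ δ : ℝ, 0 < δ → ∀ᶠ r in nhdsWithin (0 : ℝ) (Ioi 0), C * r ^ (p - s * p) < δ := by
    intro δ hδ
    have hps : 0 < p - s * p := by nlinarith
    have h1 : Tendsto (fun r : ℝ => C * r ^ (p - s * p)) (nhds 0) (nhds (C * 0 ^ (p - s * p))) :=
      ((Real.continuous_rpow_const hps.le).tendsto 0).const_mul C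
    rw [Real.zero_rpow hps.ne', mul_zero] at h1
    exact (h1.mono_left nhdsWithin_le_nhds).eventually (gt_mem_nhds hδ)
  by_cases hcrit : (N : ℝ) - s * p < θ * (p - 1)
  · obtain ⟨κ, hκ, hcore⟩ := integral_core_neg hp hs hθ hcrit
    have htail : ∃ M : ℝ, 5 / 2 ≤ M ∧ K * (M - 1) ^ (-(s * p / 2)) < κ / 4 := by
      have h1 : Tendsto (fun M : ℝ => K * (M - 1) ^ (-(s * p / 2))) atTop (nhds (K * 0)) :=
        ((tendsto_rpow_neg_atTop (by positivity)).comp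
          (tendsto_atTop_add_const_right _ (-1) tendsto_id)).const_mul K
      rw [mul_zero] at h1
      obtain ⟨M, h2, h3⟩ := ((h1.eventually (gt_mem_nhds (show 0 < κ / 4 by linarith))).and
        (eventually_ge_atTop (5 / 2))).exists
      exact ⟨M, h3, h2⟩
    obtain ⟨M, hM, hMK⟩ := htail
    have hM0 : 0 < M := by linarith
    refine ⟨-(κ / 2), 1 / M, by positivity, (div_le_one hM0).2 (by linarith),
      fun _ => by linarith, fun e he => ?_⟩
    filter_upwards [hsmall (κ / 4) (by linarith), self_mem_nhdsWithin,
      nhdsWithin_le_nhds (gt_mem_nhds (show (0 : ℝ) < 1 / 5 by norm_num))] with r h1 hr h2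
    have hr0 : 0 < r := hr
    have h2' : r < 1 / 5 := h2
    obtain ⟨hint, heq⟩ := integral_cutoffIncr_eq hN (s := s) hp hs hθ
      (show 0 < 1 / M by positivity) ((div_le_one hM0).2 (by linarith)) hr0 e he
    rw [heq]
    rw [one_div_one_div] at *
    have hball : Metric.ball ((2 : ℝ) • e) (1 / 2) ⊆
        {w | 1 < ‖w‖ ∧ ‖w‖ ≤ M ∧ r * ‖w‖ < ‖e - w‖} := by
      intro w hw
      rw [Metric.mem_ball, dist_eq_norm] at hw
      have n2 : ‖(2 : ℝ) • e‖ = 2 := by rw [norm_smul, he]; norm_num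
      have n0 := norm_sub_norm_le w ((2 : ℝ) • e)
      have n1 : 3 / 2 < ‖w‖ := by
        have := norm_sub_norm_le ((2 : ℝ) • e) w
        rw [norm_sub_rev] at hw
        linarith
      have n4 := norm_sub_one_le he w
      refine ⟨by linarith, by linarith, ?_⟩
      have : r * ‖w‖ < 1 / 5 * (5 / 2) := mul_lt_mul'' h2' (by linarith) hr0.le (norm_nonneg _)
      linarith
    have b1 := hcore e he _ (measurableSet_core e r M) (fun w hw => hw.1) hball hint
    have b2 := hC e he r hr0 (by linarith) M
    have b3 := hK e he r M (by linarith)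
    linarith
  · obtain ⟨K1, hcore⟩ := integral_core_le hN hp hs hs1 hNsp hθ
    refine ⟨K1 + 1 + K * (2 - 1) ^ (-(s * p / 2)), 1 / 2, by norm_num, by norm_num,
      fun h => absurd h hcrit, fun e he => ?_⟩
    filter_upwards [hsmall 1 one_pos, self_mem_nhdsWithin,
      nhdsWithin_le_nhds (gt_mem_nhds (show (0 : ℝ) < 1 / 5 by norm_num))] with r h1 hr h2
    have hr0 : 0 < r := hr
    have h2' : r < 1 / 5 := h2
    obtain ⟨hint, heq⟩ := integral_cutoffIncr_eq hN (s := s) (η := 1 / 2) hp hs hθ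
      (by norm_num) (by norm_num) hr0 e he
    rw [heq]
    rw [one_div_one_div] at *
    have b1 := hcore e he _ (measurableSet_core e r 2) (fun w hw => hw.1) hint
    have b2 := hC e he r hr0 (by linarith) 2
    have b3 := hK e he r 2 le_rfl
    linarith

open scoped Pointwise in
theorem integral_cutoffIncr_scale {N : ℕ} {s p θ η r : ℝ} (x : EuclideanSpace ℝ (Fin N))
    (hx : 0 < ‖x‖) :
    ∫ y in {y | r < ‖x - y‖}, cutoffIncr p θ η (‖x‖⁻¹ • y) * ‖x - y‖ ^ (-((N : ℝ) + s * p)) =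
      ‖x‖ ^ (-(s * p)) * ∫ z in {z | r / ‖x‖ < ‖‖x‖⁻¹ • x - z‖},
        cutoffIncr p θ η z * ‖‖x‖⁻¹ • x - z‖ ^ (-((N : ℝ) + s * p)) := by
  have hnorm : ∀ y, ‖‖x‖⁻¹ • x - ‖x‖⁻¹ • y‖ = ‖x - y‖ / ‖x‖ := fun y => by
    rw [← smul_sub, norm_smul, norm_inv, norm_norm]; ring
  have h := Measure.setIntegral_comp_smul_of_pos volume
    (fun z => cutoffIncr p θ η z * ‖‖x‖⁻¹ • x - z‖ ^ (-((N : ℝ) + s * p)))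
    {y | r < ‖x - y‖} (inv_pos.2 hx)
  have hset : ‖x‖⁻¹ • {y : EuclideanSpace ℝ (Fin N) | r < ‖x - y‖} =
      {z | r / ‖x‖ < ‖‖x‖⁻¹ • x - z‖} := by
    ext z
    constructor
    · rintro ⟨y, hy, rfl⟩
      simp only [mem_ofPred_eq, hnorm]
      exact div_lt_div_of_pos_right hy hx
    · intro hz
      refine ⟨‖x‖ • z, ?_, inv_smul_smul₀ hx.ne' z⟩
      have h1 := hnorm (‖x‖ • z)
      rw [inv_smul_smul₀ hx.ne'] at h1
      simp only [mem_ofPred_eq, h1] at hz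
      exact (div_lt_div_iff_of_pos_right hx).1 hz
  rw [hset, finrank_euclideanSpace_fin, smul_eq_mul] at h
  have h2 : ∀ y, cutoffIncr p θ η (‖x‖⁻¹ • y) * ‖x - y‖ ^ (-((N : ℝ) + s * p)) =
      ‖x‖ ^ (-((N : ℝ) + s * p)) * (cutoffIncr p θ η (‖x‖⁻¹ • y) *
        ‖‖x‖⁻¹ • x - ‖x‖⁻¹ • y‖ ^ (-((N : ℝ) + s * p))) := fun y => by
    rw [hnorm, Real.div_rpow (norm_nonneg _) hx.le]
    field_simp
  simp_rw [h2]
  rw [integral_const_mul, h, ← mul_assoc, inv_pow, inv_inv, ← Real.rpow_natCast,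
    ← Real.rpow_add hx]
  congr 2; ring

/-- At a point where `u` is touched from below by a truncated power, the fractional `p`-Laplacian
of `u` is controlled by that of the power. -/
theorem pvFracPLap_le_of_touching {N : ℕ} (hN : 2 ≤ N) {s p θ κ η ε : ℝ} (hp : 1 < p) (hs : 0 < s)
    (hθ : 0 < θ) (hη : 0 < η) (hη1 : η ≤ 1) (hε : 0 < ε)
    (hκ : ∀ e : EuclideanSpace ℝ (Fin N), ‖e‖ = 1 → ∀ᶠ r in nhdsWithin (0 : ℝ) (Ioi 0),
        ∫ z in {z | r < ‖e - z‖}, cutoffIncr p θ η z * ‖e - z‖ ^ (-((N : ℝ) + s * p)) ≤ κ)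
    {u : EuclideanSpace ℝ (Fin N) → ℝ} {x : EuclideanSpace ℝ (Fin N)} {L : ℝ}
    (hx : 1 ≤ η * ‖x‖) (hL : pvFracPLap N s p u x L)
    (htouch : ∀ y, u x - u y ≤ ε * ‖x‖ ^ (-θ) - ε * (max 1 ‖y‖) ^ (-θ)) :
    L ≤ (ε * ‖x‖ ^ (-θ)) ^ (p - 1) * (‖x‖ ^ (-(s * p)) * κ) := by
  have hρ1 : 1 ≤ ‖x‖ := hx.trans (mul_le_of_le_one_left (norm_nonneg _) hη1)
  have hρ : 0 < ‖x‖ := by linarith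
  set e := ‖x‖⁻¹ • x with he
  have he1 : ‖e‖ = 1 := by rw [he, norm_smul, norm_inv, norm_norm, inv_mul_cancel₀ hρ.ne']
  have hA : 0 < ε * ‖x‖ ^ (-θ) := by positivity
  have hscale : Tendsto (fun r : ℝ => r / ‖x‖) (nhdsWithin 0 (Ioi 0)) (nhdsWithin 0 (Ioi 0)) := by
    refine tendsto_nhdsWithin_iff.2 ⟨?_, ?_⟩
    · have : Tendsto (fun r : ℝ => r / ‖x‖) (nhds 0) (nhds (0 / ‖x‖)) :=
        tendsto_id.div_const _
      rw [zero_div] at this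
      exact this.mono_left nhdsWithin_le_nhds
    · filter_upwards [self_mem_nhdsWithin] with r hr
      exact div_pos hr hρ
  refine le_of_tendsto hL.2 ?_
  filter_upwards [hscale.eventually (hκ e he1), self_mem_nhdsWithin] with r h1 hr
  have hr0 : 0 < r := hr
  have hm : MeasurableSet {y : EuclideanSpace ℝ (Fin N) | r < ‖x - y‖} :=
    measurableSet_lt measurable_const (measurable_const.sub measurable_id).norm
  have hbound : ∀ y, oddPow p (u x - u y) ≤
      (ε * ‖x‖ ^ (-θ)) ^ (p - 1) * cutoffIncr p θ η (‖x‖⁻¹ • y) := by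
    intro y
    have hny : ‖‖x‖⁻¹ • y‖ = ‖y‖ / ‖x‖ := by
      rw [norm_smul, norm_inv, norm_norm]; ring
    unfold cutoffIncr
    rw [hny]
    split_ifs with hc
    · rw [← oddPow_mul _ hA]
      refine oddPow_mono hp ((htouch y).trans (le_of_eq ?_))
      rw [le_div_iff₀ hρ] at hc
      have hy : 0 < ‖y‖ := by linarith
      rw [max_eq_right (hx.trans hc), Real.div_rpow hy.le hρ.le]
      field_simp
    · rw [mul_zero]
      have h0 : oddPow p 0 = 0 := by simp [oddPow]
      rw [← h0]
      refine oddPow_mono hp ((htouch y).trans ?_)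
      rw [not_le, div_lt_iff₀ hρ] at hc
      have hmax : max 1 ‖y‖ ≤ ‖x‖ :=
        max_le hρ1 (hc.le.trans (mul_le_of_le_one_left hρ.le hη1))
      have := Real.rpow_le_rpow_of_nonpos (lt_max_of_lt_left one_pos) hmax (neg_nonpos.2 hθ.le)
      have := mul_le_mul_of_nonneg_left this hε.le
      linarith
  calc ∫ y in {y | r < ‖x - y‖}, |u x - u y| ^ (p - 2) * (u x - u y) *
        ‖x - y‖ ^ (-((N : ℝ) + s * p))
      ≤ ∫ y in {y | r < ‖x - y‖}, (ε * ‖x‖ ^ (-θ)) ^ (p - 1) *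
        (cutoffIncr p θ η (‖x‖⁻¹ • y) * ‖x - y‖ ^ (-((N : ℝ) + s * p))) := by
        refine setIntegral_mono_on (hL.1 r hr0)
          ((integrableOn_cutoffIncr_smul hN hp hs hθ hη hr0 x _).const_mul _) hm fun y _ => ?_
        rw [← mul_assoc]
        exact mul_le_mul_of_nonneg_right (hbound y) (by positivity)
    _ = (ε * ‖x‖ ^ (-θ)) ^ (p - 1) * (‖x‖ ^ (-(s * p)) *
        ∫ z in {z | r / ‖x‖ < ‖e - z‖}, cutoffIncr p θ η z *
          ‖e - z‖ ^ (-((N : ℝ) + s * p))) := by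
        rw [integral_const_mul, integral_cutoffIncr_scale x hρ]
    _ ≤ _ := by gcongr

theorem exists_pos_le_of_lowerSemicontinuous {N : ℕ} {u : EuclideanSpace ℝ (Fin N) → ℝ}
    (hpos : ∀ x, 0 < u x) (hlsc : LowerSemicontinuous u) {R : ℝ} (hR : 0 ≤ R) :
    ∃ ε : ℝ, 0 < ε ∧ ε ≤ 1 ∧ ∀ y, ‖y‖ ≤ R → ε ≤ u y := by
  obtain ⟨x, -, hx⟩ := (hlsc.lowerSemicontinuousOn (Metric.closedBall 0 R)).exists_isMinOn
    ⟨0, by simpa using hR⟩ (isCompact_closedBall 0 R)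
  exact ⟨min (u x) 1, lt_min (hpos x) one_pos, min_le_right _ _,
    fun y hy => (min_le_left _ _).trans (hx (by simpa using hy))⟩

/-- A truncated power lying below `u` near the origin either lies below `u` everywhere, or can be
translated to touch `u` from below at some point. -/
theorem exists_touching {N : ℕ} {u : EuclideanSpace ℝ (Fin N) → ℝ}
    (hpos : ∀ x, 0 < u x) (hlsc : LowerSemicontinuous u) {θ ε R : ℝ} (hθ : 0 < θ) (hε : 0 < ε)
    (hR : ∀ y, ‖y‖ ≤ R → ε ≤ u y) :
    (∀ y, ε * (max 1 ‖y‖) ^ (-θ) ≤ u y) ∨ ∃ x, R < ‖x‖ ∧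
      ∀ y, u x - u y ≤ ε * (max 1 ‖x‖) ^ (-θ) - ε * (max 1 ‖y‖) ^ (-θ) := by
  refine or_iff_not_imp_left.2 fun h => ?_
  push Not at h
  obtain ⟨z, hz⟩ := h
  have hcont : Continuous fun y : EuclideanSpace ℝ (Fin N) => ε * (max 1 ‖y‖) ^ (-θ) :=
    continuous_const.mul ((continuous_const.max continuous_norm).rpow_const
      fun y => Or.inl (lt_max_of_lt_left one_pos).ne')
  have hflsc : LowerSemicontinuous fun y => u y + -(ε * (max 1 ‖y‖) ^ (-θ)) :=
    hlsc.add hcont.neg.lowerSemicontinuous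
  obtain ⟨ρ, hρ, hρ1⟩ : ∃ ρ : ℝ, (∀ τ, ρ ≤ τ → ε * τ ^ (-θ) < ε * (max 1 ‖z‖) ^ (-θ) - u z) ∧
      max 1 ‖z‖ ≤ ρ := by
    have h1 : Tendsto (fun τ : ℝ => ε * τ ^ (-θ)) atTop (nhds (ε * 0)) :=
      (tendsto_rpow_neg_atTop hθ).const_mul ε
    rw [mul_zero] at h1
    obtain ⟨a, ha⟩ := eventually_atTop.1 (h1.eventually (gt_mem_nhds (sub_pos.2 hz)))
    exact ⟨max a (max 1 ‖z‖), fun τ hτ => ha τ ((le_max_left _ _).trans hτ), le_max_right _ _⟩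
  have hzρ : ‖z‖ ≤ ρ := (le_max_right _ _).trans hρ1
  have h1ρ : 1 ≤ ρ := (le_max_left _ _).trans hρ1
  obtain ⟨x, -, hx⟩ := (hflsc.lowerSemicontinuousOn (Metric.closedBall 0 ρ)).exists_isMinOn
    ⟨z, by simpa using hzρ⟩ (isCompact_closedBall 0 ρ)
  have hxz : u x + -(ε * (max 1 ‖x‖) ^ (-θ)) ≤ u z + -(ε * (max 1 ‖z‖) ^ (-θ)) :=
    hx (by simpa using hzρ)
  refine ⟨x, ?_, fun y => ?_⟩
  · by_contra! hxR
    have h1 := hR x hxR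
    have h2 : (max 1 ‖x‖) ^ (-θ) ≤ 1 :=
      Real.rpow_le_one_of_one_le_of_nonpos (le_max_left _ _) (neg_nonpos.2 hθ.le)
    have h3 := mul_le_mul_of_nonneg_left h2 hε.le
    linarith
  · rcases le_or_gt ‖y‖ ρ with hy | hy
    · have : u x + -(ε * (max 1 ‖x‖) ^ (-θ)) ≤ u y + -(ε * (max 1 ‖y‖) ^ (-θ)) :=
        hx (by simpa using hy)
      linarith
    · have h1 := hρ ‖y‖ hy.le
      rw [max_eq_right (h1ρ.trans hy.le)]
      have := hpos y
      linarith

theorem norm_gradient_ge_of_touching {N : ℕ} {u : EuclideanSpace ℝ (Fin N) → ℝ} {θ ε : ℝ}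
    {x : EuclideanSpace ℝ (Fin N)} (hx : 1 < ‖x‖) (hd : DifferentiableAt ℝ u x)
    (htouch : ∀ y, u x - u y ≤ ε * ‖x‖ ^ (-θ) - ε * (max 1 ‖y‖) ^ (-θ)) :
    ε * θ * ‖x‖ ^ (-θ - 1) ≤ ‖gradient u x‖ := by
  have hx0 : 0 < ‖x‖ := by linarith
  have hmin : IsLocalMin (fun τ : ℝ => u (τ • x) - ε * (τ * ‖x‖) ^ (-θ)) 1 := by
    filter_upwards [lt_mem_nhds ((inv_lt_one₀ hx0).2 hx)] with τ hτ
    have hτ0 : 0 < τ := (inv_pos.2 hx0).trans hτ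
    have h1 : 1 < τ * ‖x‖ := by rwa [inv_lt_iff_one_lt_mul₀ hx0] at hτ
    have h2 := htouch (τ • x)
    rw [norm_smul, Real.norm_of_nonneg hτ0.le, max_eq_right h1.le] at h2
    simp only [one_smul, one_mul]
    linarith
  have hu : HasDerivAt (fun τ : ℝ => u (τ • x)) (fderiv ℝ u x x) 1 := by
    have h1 : HasDerivAt (fun τ : ℝ => τ • x) ((1 : ℝ) • x) 1 := (hasDerivAt_id 1).smul_const x
    have h2 : HasFDerivAt u (fderiv ℝ u x) ((1 : ℝ) • x) := by
      rw [one_smul]; exact hd.hasFDerivAt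
    have h3 := h2.comp_hasDerivAt (1 : ℝ) h1
    rwa [one_smul] at h3
  have hφ : HasDerivAt (fun τ : ℝ => ε * (τ * ‖x‖) ^ (-θ))
      (ε * (1 * ‖x‖ * (-θ) * (1 * ‖x‖) ^ (-θ - 1))) 1 :=
    (((hasDerivAt_id (1 : ℝ)).mul_const ‖x‖).rpow_const
      (Or.inl (by simpa using hx0.ne'))).const_mul ε
  have hzero := hmin.hasDerivAt_eq_zero (hu.sub hφ)
  have hgrad : ‖gradient u x‖ = ‖fderiv ℝ u x‖ := by
    rw [gradient, LinearIsometryEquiv.norm_map]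
  have hop := (neg_le_abs _).trans ((fderiv ℝ u x).le_opNorm x)
  rw [one_mul] at hzero
  rw [hgrad]
  refine le_of_mul_le_mul_right ?_ hx0
  linarith

/-- `u` is bounded below by a positive multiple of the truncated power of exponent `-θ`. -/
def HasPowerLowerBound {N : ℕ} (u : EuclideanSpace ℝ (Fin N) → ℝ) (θ : ℝ) : Prop :=
  ∃ C : ℝ, 0 < C ∧ ∀ x, C * (max 1 ‖x‖) ^ (-θ) ≤ u x

theorem HasPowerLowerBound.mono {N : ℕ} {u : EuclideanSpace ℝ (Fin N) → ℝ} {θ θ' : ℝ}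
    (h : HasPowerLowerBound u θ) (hθ : θ ≤ θ') : HasPowerLowerBound u θ' := by
  obtain ⟨C, hC, hu⟩ := h
  refine ⟨C, hC, fun x => (mul_le_mul_of_nonneg_left ?_ hC.le).trans (hu x)⟩
  exact Real.rpow_le_rpow_of_exponent_le (le_max_left _ _) (neg_le_neg hθ)

theorem hasPowerLowerBound_of_not_touching {N : ℕ} {u : EuclideanSpace ℝ (Fin N) → ℝ}
    (hpos : ∀ x, 0 < u x) (hlsc : LowerSemicontinuous u) {θ R : ℝ} (hθ : 0 < θ) (hR : 1 ≤ R)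
    (H : ∀ ε : ℝ, 0 < ε → ε ≤ 1 → ∀ x, R < ‖x‖ →
      ¬ ∀ y, u x - u y ≤ ε * ‖x‖ ^ (-θ) - ε * (max 1 ‖y‖) ^ (-θ)) :
    HasPowerLowerBound u θ := by
  obtain ⟨ε, hε, hε1, hεR⟩ := exists_pos_le_of_lowerSemicontinuous hpos hlsc (zero_le_one.trans hR)
  rcases exists_touching hpos hlsc hθ hε hεR with h | ⟨x, hx, htouch⟩
  · exact ⟨ε, hε, h⟩
  · rw [max_eq_right (hR.trans hx.le)] at htouch
    exact absurd htouch (H ε hε hε1 x hx)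

theorem hasPowerLowerBound_of_supercritical {N : ℕ} (hN : 2 ≤ N) {s p θ R₀ : ℝ} (hp : 1 < p)
    (hs : 0 < s) (hs1 : s < 1) (hNsp : s * p < N) (hθ : 0 < θ)
    (hcrit : (N : ℝ) - s * p < θ * (p - 1))
    {u L : EuclideanSpace ℝ (Fin N) → ℝ} (hpos : ∀ x, 0 < u x) (hlsc : LowerSemicontinuous u)
    (hpv : ∀ x, R₀ ≤ ‖x‖ → pvFracPLap N s p u x (L x)) (hL : ∀ x, R₀ ≤ ‖x‖ → 0 ≤ L x) :
    HasPowerLowerBound u θ := by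
  obtain ⟨κ, η, hη, hη1, hκ0, hκ⟩ := cutoff_integral_bound hN hp hs hs1 hNsp hθ
  refine hasPowerLowerBound_of_not_touching hpos hlsc hθ (R := max (max R₀ (1 / η)) 1)
    (le_max_right _ _) fun ε hε _ x hx htouch => ?_
  simp only [max_lt_iff] at hx
  obtain ⟨⟨hx1, hx2⟩, hx3⟩ := hx
  have h1 := pvFracPLap_le_of_touching hN hp hs hθ hη hη1 hε hκ
    (by rw [div_lt_iff₀' hη] at hx2; exact hx2.le) (hpv x hx1.le) htouch
  have hx0 : 0 < ‖x‖ := by linarith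
  have h2 : (ε * ‖x‖ ^ (-θ)) ^ (p - 1) * (‖x‖ ^ (-(s * p)) * κ) < 0 :=
    mul_neg_of_pos_of_neg (by positivity) (mul_neg_of_pos_of_neg (by positivity) (hκ0 hcrit))
  linarith [hL x hx1.le]

theorem HasPowerLowerBound.improve {N : ℕ} (hN : 2 ≤ N) {s p t m θ θ' R₀ : ℝ} (hp : 1 < p)
    (hs : 0 < s) (hs1 : s < 1) (hNsp : s * p < N) (ht : 0 ≤ t) (hm : 0 ≤ m) (hmp : m ≤ p - 1)
    (hθ : 0 < θ) (hexp : θ' * t + (θ + 1) * m < θ * (p - 1) + s * p)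
    {u L : EuclideanSpace ℝ (Fin N) → ℝ} (hpos : ∀ x, 0 < u x) (hlsc : LowerSemicontinuous u)
    (hdiff : ∀ x, R₀ ≤ ‖x‖ → DifferentiableAt ℝ u x)
    (hpv : ∀ x, R₀ ≤ ‖x‖ → pvFracPLap N s p u x (L x))
    (hL : ∀ x, R₀ ≤ ‖x‖ → u x ^ t * ‖gradient u x‖ ^ m ≤ L x)
    (hlow : HasPowerLowerBound u θ') : HasPowerLowerBound u θ := by
  obtain ⟨c, hc, hcu⟩ := hlow
  obtain ⟨κ, η, hη, hη1, -, hκ⟩ := cutoff_integral_bound hN hp hs hs1 hNsp hθ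
  set γ := θ * (p - 1) + s * p - (θ' * t + (θ + 1) * m) with hγ
  have hγ0 : 0 < γ := sub_pos.2 hexp
  have hct : 0 < c ^ t * θ ^ m := by positivity
  obtain ⟨R₁, hR₁⟩ : ∃ R₁ : ℝ, ∀ τ, R₁ ≤ τ → κ < τ ^ γ * (c ^ t * θ ^ m) :=
    eventually_atTop.1 (((tendsto_rpow_atTop hγ0).atTop_mul_const hct).eventually_gt_atTop κ)
  refine hasPowerLowerBound_of_not_touching hpos hlsc hθ (R := max (max (max R₀ R₁) (1 / η)) 1)
    (le_max_right _ _) fun ε hε hε1 x hx htouch => ?_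
  simp only [max_lt_iff] at hx
  obtain ⟨⟨⟨hx1, hxR⟩, hx2⟩, hx3⟩ := hx
  have hx0 : 0 < ‖x‖ := by linarith
  have h1 := pvFracPLap_le_of_touching hN hp hs hθ hη hη1 hε hκ
    (by rw [div_lt_iff₀' hη] at hx2; exact hx2.le) (hpv x hx1.le) htouch
  have h2 := norm_gradient_ge_of_touching hx3 (hdiff x hx1.le) htouch
  have h3 := hcu x
  rw [max_eq_right hx3.le] at h3
  have h4 : (c * ‖x‖ ^ (-θ')) ^ t * (ε * θ * ‖x‖ ^ (-θ - 1)) ^ m ≤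
      u x ^ t * ‖gradient u x‖ ^ m :=
    mul_le_mul (Real.rpow_le_rpow (by positivity) h3 ht)
      (Real.rpow_le_rpow (by positivity) h2 hm) (by positivity)
      (Real.rpow_nonneg (hpos x).le _)
  have h5 := h4.trans ((hL x hx1.le).trans h1)
  have e1 : (c * ‖x‖ ^ (-θ')) ^ t * (ε * θ * ‖x‖ ^ (-θ - 1)) ^ m =
      ‖x‖ ^ (-(θ * (p - 1)) - s * p) * (ε ^ m * (‖x‖ ^ γ * (c ^ t * θ ^ m))) := by
    rw [Real.mul_rpow hc.le (by positivity), Real.mul_rpow (by positivity) (by positivity),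
      Real.mul_rpow hε.le hθ.le, ← Real.rpow_mul hx0.le, ← Real.rpow_mul hx0.le]
    have : ‖x‖ ^ (-θ' * t) * ‖x‖ ^ ((-θ - 1) * m) =
        ‖x‖ ^ (-(θ * (p - 1)) - s * p) * ‖x‖ ^ γ := by
      rw [← Real.rpow_add hx0, ← Real.rpow_add hx0]
      congr 1; rw [hγ]; ring
    linear_combination c ^ t * ε ^ m * θ ^ m * this
  have e2 : (ε * ‖x‖ ^ (-θ)) ^ (p - 1) * (‖x‖ ^ (-(s * p)) * κ) =
      ‖x‖ ^ (-(θ * (p - 1)) - s * p) * (ε ^ (p - 1) * κ) := by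
    rw [Real.mul_rpow hε.le (by positivity), ← Real.rpow_mul hx0.le,
      sub_eq_add_neg (-(θ * (p - 1))), Real.rpow_add hx0, neg_mul]
    ring
  rw [e1, e2] at h5
  have h6 := le_of_mul_le_mul_left h5 (by positivity)
  have h7 := hR₁ ‖x‖ hxR.le
  have h8 : ε ^ (p - 1) ≤ ε ^ m := Real.rpow_le_rpow_of_exponent_ge hε hε1 hmp
  have h9 : 0 < ‖x‖ ^ γ * (c ^ t * θ ^ m) := by positivity
  have h10 : ε ^ (p - 1) * κ < ε ^ (p - 1) * (‖x‖ ^ γ * (c ^ t * θ ^ m)) :=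
    mul_lt_mul_of_pos_left h7 (by positivity)
  have h11 := mul_le_mul_of_nonneg_right h8 h9.le
  linarith

theorem HasPowerLowerBound.of_improve {N : ℕ} {u : EuclideanSpace ℝ (Fin N) → ℝ}
    {p t m b θ θ₁ : ℝ} (hmp : m ≤ p - 1) (hmb : m < b)
    (hθ : 0 < θ) (hθ₁ : 0 < θ₁) (h₁ : θ₁ * t + (θ₁ + 1) * m < θ₁ * (p - 1) + b)
    (himp : ∀ α β : ℝ, 0 < β → α * t + (β + 1) * m < β * (p - 1) + b →
      HasPowerLowerBound u α → HasPowerLowerBound u β)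
    (h : HasPowerLowerBound u θ₁) : HasPowerLowerBound u θ := by
  set g := min (b - m) (θ₁ * (p - 1) + b - (θ₁ * t + (θ₁ + 1) * m)) with hg
  have hg0 : 0 < g := lt_min (sub_pos.2 hmb) (sub_pos.2 h₁)
  have hconv : ∀ α, 0 ≤ α → α ≤ θ₁ → g ≤ α * (p - 1) + b - (α * t + (α + 1) * m) := by
    intro α h0 h1
    have g1 : g ≤ b - m := min_le_left _ _
    have g2 : g ≤ θ₁ * (p - 1) + b - (θ₁ * t + (θ₁ + 1) * m) := min_le_right _ _
    refine le_of_mul_le_mul_left ?_ hθ₁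
    nlinarith [mul_le_mul_of_nonneg_left g1 (sub_nonneg.2 h1), mul_le_mul_of_nonneg_left g2 h0]
  obtain ⟨d, hd, hdg⟩ : ∃ d : ℝ, 0 < d ∧ d * (p - 1 - m) < g := by
    have h0 : 0 ≤ p - 1 - m := by linarith
    refine ⟨g / (p - 1 - m + 1), by positivity, ?_⟩
    rw [div_mul_eq_mul_div, div_lt_iff₀ (by linarith)]
    nlinarith
  set θ₂ := min θ θ₁ with hθ₂
  have hθ₂0 : 0 < θ₂ := lt_min hθ hθ₁
  have hiter : ∀ n : ℕ, HasPowerLowerBound u (max θ₂ (θ₁ - n * d)) := by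
    intro n
    induction n with
    | zero => exact h.mono (by simp)
    | succ k ih =>
      refine himp _ _ (lt_max_of_lt_left hθ₂0) ?_ ih
      set α := max θ₂ (θ₁ - k * d) with hα
      set β := max θ₂ (θ₁ - (k + 1 : ℕ) * d) with hβ
      have hα0 : 0 ≤ α := (le_max_left _ _).trans' hθ₂0.le
      have hα1 : α ≤ θ₁ := max_le (min_le_right _ _) (sub_le_self _ (by positivity))
      have hαβ : α - d ≤ β := by
        push_cast at hβ
        rw [sub_le_iff_le_add]
        refine max_le ?_ ?_
        · linarith [le_max_left θ₂ (θ₁ - (k + 1) * d)]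
        · linarith [le_max_right θ₂ (θ₁ - (k + 1) * d)]
      have := hconv α hα0 hα1
      nlinarith [mul_le_mul_of_nonneg_right hαβ (show 0 ≤ p - 1 - m by linarith)]
  obtain ⟨n, hn⟩ := exists_nat_gt (θ₁ / d)
  rw [div_lt_iff₀ hd] at hn
  refine (hiter n).mono (max_le (min_le_left _ _) ?_)
  linarith

/-- Improved lower bound for positive supersolutions of
`(-Δ_p)^s u ≥ u^t |∇u|^m` in an exterior domain: for every `θ ∈ (0, N/(p-1))`,
`u(x) ≥ C |x|^{-θ}` on the closure of `Ω` intersected with `{|x| ≥ 1}`. -/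
theorem stmt_9 (N : ℕ) (hN : 2 ≤ N) (s p t m : ℝ)
    (hs : 0 < s) (hs1 : s < 1) (hp : 1 < p)
    (hNsp : s * p < N)
    (ht : 0 ≤ t) (hm : 0 ≤ m)
    (hM : (p - 1 < s * p ∧ m ≤ p - 1) ∨ (s * p ≤ p - 1 ∧ m < s * p))
    (hsub : t * ((N : ℝ) - s * p) + m * ((N : ℝ) - (s * p - p + 1)) < N * (p - 1))
    (Ω : Set (EuclideanSpace ℝ (Fin N))) (hΩo : IsOpen Ω)
    (hΩe : ∃ R : ℝ, 0 < R ∧ {x : EuclideanSpace ℝ (Fin N) | R ≤ ‖x‖} ⊆ Ω)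
    (u : EuclideanSpace ℝ (Fin N) → ℝ)
    (hpos : ∀ x, 0 < u x) (hlsc : LowerSemicontinuous u)
    (hdiff : ∀ x ∈ Ω, DifferentiableAt ℝ u x)
    (L : EuclideanSpace ℝ (Fin N) → ℝ)
    (hpv : ∀ x ∈ Ω, pvFracPLap N s p u x (L x))
    (hL : ∀ x ∈ Ω, u x ^ t * ‖gradient u x‖ ^ m ≤ L x)
    (θ : ℝ) (hθ1 : 0 < θ) (hθ2 : θ < (N : ℝ) / (p - 1)) :
    ∃ C : ℝ, 0 < C ∧ ∀ x ∈ closure Ω, 1 ≤ ‖x‖ →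
      C * ‖x‖ ^ (-θ) ≤ u x := by
  obtain ⟨R, -, hR⟩ := hΩe
  have hp1 : 0 < p - 1 := by linarith
  have hsp : 0 < s * p := by positivity
  have hmp : m ≤ p - 1 := by rcases hM with h | h <;> linarith [h.1, h.2]
  have hmsp : m < s * p := by rcases hM with h | h <;> linarith [h.1, h.2]
  obtain ⟨α, hα, hαθ⟩ : ∃ α : ℝ, (N : ℝ) - s * p < α * (p - 1) ∧
      α * t + (α + 1) * m < α * (p - 1) + s * p := by
    have h1 : Tendsto (fun α : ℝ => α * (p - 1) + s * p - (α * t + (α + 1) * m))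
        (nhds (((N : ℝ) - s * p) / (p - 1))) (nhds (((N : ℝ) - s * p) / (p - 1) * (p - 1) + s * p -
          (((N : ℝ) - s * p) / (p - 1) * t + (((N : ℝ) - s * p) / (p - 1) + 1) * m))) :=
      Continuous.tendsto (by fun_prop) _
    have h2 : 0 < ((N : ℝ) - s * p) / (p - 1) * (p - 1) + s * p -
        (((N : ℝ) - s * p) / (p - 1) * t + (((N : ℝ) - s * p) / (p - 1) + 1) * m) := by
      have : ((N : ℝ) - s * p) / (p - 1) * (p - 1) + s * p -
        (((N : ℝ) - s * p) / (p - 1) * t + (((N : ℝ) - s * p) / (p - 1) + 1) * m) =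
        (N * (p - 1) - (t * ((N : ℝ) - s * p) + m * ((N : ℝ) - (s * p - p + 1)))) / (p - 1) := by
        field_simp
        ring
      rw [this]
      exact div_pos (by linarith) hp1
    obtain ⟨α, h3, h4⟩ := (((h1.eventually (lt_mem_nhds h2)).filter_mono
      (nhdsWithin_le_nhds (s := Ioi (((N : ℝ) - s * p) / (p - 1))))).and self_mem_nhdsWithin).exists
    refine ⟨α, (div_lt_iff₀ hp1).1 h4, by linarith⟩
  have hα0 : 0 < α := pos_of_mul_pos_left (by linarith : 0 < α * (p - 1)) hp1.le
  have hbase : HasPowerLowerBound u α :=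
    hasPowerLowerBound_of_supercritical hN hp hs hs1 hNsp hα0 hα hpos hlsc
      (fun x hx => hpv x (hR hx)) fun x hx => (hL x (hR hx)).trans'
        (mul_nonneg (Real.rpow_nonneg (hpos x).le _) (by positivity))
  obtain ⟨C, hC, hCu⟩ := hbase.of_improve hmp hmsp hθ1 hα0 hαθ fun _ _ hβ hexp =>
    HasPowerLowerBound.improve hN hp hs hs1 hNsp ht hm hmp hβ hexp hpos hlsc
      (fun x hx => hdiff x (hR hx)) (fun x hx => hpv x (hR hx)) fun x hx => hL x (hR hx)
  refine ⟨C, hC, fun x _ hx => ?_⟩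
  have := hCu x
  rwa [max_eq_right hx] at this
end

section
/- Let 0 < s < 1 < p, let N be a real number (or integer) with N > sp, and let t, m ≥ 0 satisfy condition (M) and t(N − sp) + m(N − (sp − p + 1)) < N(p − 1). Then for every θ ∈ (0, (N−sp)/(p−1)] there exist a natural number k ≥ 1 and real numbers σ₀ > σ₁ > ⋯ > σ_k with (N−sp)/(p−1) < σ₀ < N/(p−1), σ_k = θ, σ_i > 0 for every i, and such that for every i ∈ {0, 1, …, k−1} one has (σ_{i+1} + 1) m + t σ_i < (σ_{i+1} + 1)(p − 1) + (sp − p + 1). -/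
open Filter Topology in
/-- An affine function that is positive at `a` is positive at some point of `(a, b)`. -/
theorem exists_between_affine_pos {a b c A : ℝ} (hab : a < b) (h : 0 < c * a + A) :
    ∃ x, (a < x ∧ x < b) ∧ 0 < c * x + A := by
  have hc : ContinuousAt (fun x : ℝ => c * x + A) a := by fun_prop
  have h₁ : ∀ᶠ x in 𝓝[>] a, 0 < c * x + A :=
    (hc.eventually (lt_mem_nhds h)).filter_mono nhdsWithin_le_nhds
  exact (Filter.Eventually.and (Ioo_mem_nhdsGT hab) h₁).exists

/-- An arithmetic progression descending from `b` to `θ` with small enough steps satisfies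
`t * σ i < q * σ (i + 1) + A` as soon as `t * x < q * x + A` at `x = 0` and `x = b`. -/
theorem exists_descending_chain {q t A b θ : ℝ} (hA : 0 < A)
    (hb : 0 < (q - t) * b + A) (hθ : 0 < θ) (hθb : θ < b) :
    ∃ k : ℕ, 1 ≤ k ∧ ∃ σ : ℕ → ℝ, σ 0 = b ∧ σ k = θ ∧ (∀ i ≤ k, 0 < σ i) ∧
      (∀ i < k, σ (i + 1) < σ i) ∧ (∀ i < k, t * σ i < q * σ (i + 1) + A) := by
  obtain ⟨δ, hδ, hδA, hδb⟩ : ∃ δ, 0 < δ ∧ δ ≤ A ∧ δ ≤ (q - t) * b + A :=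
    ⟨min A ((q - t) * b + A), lt_min hA hb, min_le_left _ _, min_le_right _ _⟩
  have hmargin (x : ℝ) (hx : 0 ≤ x) (hxb : x ≤ b) : δ ≤ (q - t) * x + A := by
    rcases le_total 0 (q - t) with h | h
    · nlinarith [mul_nonneg h hx]
    · nlinarith [mul_le_mul_of_nonpos_left hxb h]
  obtain ⟨n, hn⟩ := exists_nat_gt (q * (b - θ) / δ)
  have hk : (0 : ℝ) < ((n + 1 : ℕ) : ℝ) := by positivity
  obtain ⟨h, hh⟩ : ∃ h, h = (b - θ) / ((n + 1 : ℕ) : ℝ) := ⟨_, rfl⟩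
  have hpos : 0 < h := hh ▸ div_pos (sub_pos.2 hθb) hk
  have hkh : ((n + 1 : ℕ) : ℝ) * h = b - θ := by rw [hh]; field_simp
  have hstep : q * h < δ := by
    rw [div_lt_iff₀ hδ] at hn
    rw [hh, ← mul_div_assoc, div_lt_iff₀ hk]
    push_cast
    linarith
  have hge (i : ℕ) (hi : i ≤ n + 1) : θ ≤ b - i * h := by
    have : (i : ℝ) * h ≤ ((n + 1 : ℕ) : ℝ) * h := by gcongr
    linarith
  refine ⟨n + 1, by lia, fun i => b - i * h, by simp, by linarith,
    fun i hi => hθ.trans_le (hge i hi), fun i _ => ?_, fun i hi => ?_⟩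
  · push_cast
    linarith
  · have := hmargin (b - i * h) (hθ.le.trans (hge i hi.le)) (by
      have : 0 ≤ (i : ℝ) * h := by positivity
      linarith)
    push_cast
    linarith


/-- The arithmetic core of the iterative improvement: for every
`θ ∈ (0, (N-sp)/(p-1)]` there is a finite decreasing chain of positive exponents
`σ₀ > σ₁ > ⋯ > σ_k = θ`, starting in `((N-sp)/(p-1), N/(p-1))`, along which each
consecutive pair satisfies the improvement inequality. -/
theorem stmt_10 (N s p t m : ℝ)
    (hs : 0 < s) (hs1 : s < 1) (hp : 1 < p)
    (hNsp : s * p < N)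
    (ht : 0 ≤ t) (hm : 0 ≤ m)
    (hM : (p - 1 < s * p ∧ m ≤ p - 1) ∨ (s * p ≤ p - 1 ∧ m < s * p))
    (hsub : t * (N - s * p) + m * (N - (s * p - p + 1)) < N * (p - 1))
    (θ : ℝ) (hθ0 : 0 < θ) (hθ1 : θ ≤ (N - s * p) / (p - 1)) :
    ∃ k : ℕ, 1 ≤ k ∧ ∃ σ : ℕ → ℝ,
      ((N - s * p) / (p - 1) < σ 0 ∧ σ 0 < N / (p - 1)) ∧
      σ k = θ ∧
      (∀ i ≤ k, 0 < σ i) ∧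
      (∀ i < k, σ (i + 1) < σ i) ∧
      (∀ i < k, (σ (i + 1) + 1) * m + t * σ i
          < (σ (i + 1) + 1) * (p - 1) + (s * p - p + 1)) := by
  have hp' : 0 < p - 1 := by linarith
  have hA : 0 < s * p - m := by rcases hM with h | h <;> linarith
  have hcrit : 0 < (p - 1 - m - t) * ((N - s * p) / (p - 1)) + (s * p - m) := by
    have : (p - 1 - m - t) * ((N - s * p) / (p - 1)) + (s * p - m) =
        (N * (p - 1) - (t * (N - s * p) + m * (N - (s * p - p + 1)))) / (p - 1) := by
      field_simp
      ring
    rw [this]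
    exact div_pos (sub_pos.2 hsub) hp'
  have hlt : (N - s * p) / (p - 1) < N / (p - 1) := by
    have : 0 < s * p := by positivity
    gcongr
    linarith
  obtain ⟨b, hb, hbpos⟩ := exists_between_affine_pos hlt hcrit
  obtain ⟨k, hk, σ, hσ0, hσk, hpos, hdec, himp⟩ :=
    exists_descending_chain hA hbpos hθ0 (hθ1.trans_lt hb.1)
  refine ⟨k, hk, σ, hσ0 ▸ hb, hσk, hpos, hdec, fun i hi => ?_⟩
  linarith [himp i hi]
end
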